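/- arXiv:2207.05302 — 2 statements merged into one kernel-verified Lean document; each statement's English description precedes it below -/
import Mathlib

section
/- Suppose 𝒜 = {a₀, a₁} with Pr(A = a) > 0 for both a, let r : 𝒳 → [0,1] be measurable, and let 𝒰 be the family of utility functions u_λ(x) = r(x) + λ·1{α(x) = a₁} indexed by λ ≥ 0. Suppose that for each a ∈ 𝒜 the conditional distribution of r(X) given A = a is the Beta distribution with parameters (α_a, β_a), i.e., has density proportional to x^{α_a−1}(1−x)^{β_a−1} on (0,1), where 1 < α_{a₁} < α_{a₀} and 1 < β_{a₀} < β_{a₁}. Let U be uniform on [0,1] independent of X and D = 1{U ≤ d(X)}. Then any feasible policy d satisfying E[r(X) | A = a₀, D = 0] = E[r(X) | A = a₁, D = 0] (the condition implied by counterfactual predictive parity when r(x) = E[Y(1) | X = x] for a binary potential outcome Y(1)) is strongly Pareto dominated with respect to 𝒰. -/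
open MeasureTheory

namespace CPP

/-- Unnormalised Beta density. -/
noncomputable def bd (p q x : ℝ) : ℝ := x ^ p * (1 - x) ^ q

lemma bd_cont {p q : ℝ} (hp : 0 < p) (hq : 0 < q) : Continuous (bd p q) := by
  unfold bd
  exact (continuous_id.rpow_const (fun _ => Or.inr hp.le)).mul
    ((continuous_const.sub continuous_id).rpow_const (fun _ => Or.inr hq.le))

lemma bd_pos (p q : ℝ) {x : ℝ} (h0 : 0 < x) (h1 : x < 1) : 0 < bd p q x :=
  mul_pos (Real.rpow_pos_of_pos h0 _) (Real.rpow_pos_of_pos (by linarith) _)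

lemma bd_int_pos {p q : ℝ} (hp : 0 < p) (hq : 0 < q) {s t : ℝ} (hs : 0 ≤ s) (hst : s < t)
    (ht : t ≤ 1) : 0 < ∫ x in s..t, bd p q x :=
  intervalIntegral.intervalIntegral_pos_of_pos_on ((bd_cont hp hq).intervalIntegrable _ _)
    (fun x hx => bd_pos p q (by linarith [hx.1]) (by linarith [hx.2])) hst

/-- Strict monotone likelihood ratio. -/
lemma bd_ratio {p0 q0 p1 q1 : ℝ} (hp : p1 < p0) (hq : q0 < q1) {x y : ℝ}
    (hx : 0 < x) (hxy : x < y) (hy : y < 1) :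
    bd p0 q0 x * bd p1 q1 y < bd p0 q0 y * bd p1 q1 x := by
  have hx1 : 0 < 1 - x := by linarith
  have hy1 : 0 < 1 - y := by linarith
  have hy0 : 0 < y := by linarith
  have e1 : ∀ z : ℝ, 0 < z → z ^ p0 = z ^ p1 * z ^ (p0 - p1) := fun z hz => by
    rw [← Real.rpow_add hz]; congr 1; ring
  have e2 : ∀ z : ℝ, 0 < z → z ^ q1 = z ^ q0 * z ^ (q1 - q0) := fun z hz => by
    rw [← Real.rpow_add hz]; congr 1; ring
  have i1 : x ^ (p0 - p1) < y ^ (p0 - p1) := Real.rpow_lt_rpow hx.le hxy (by linarith)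
  have i2 : (1 - y) ^ (q1 - q0) < (1 - x) ^ (q1 - q0) :=
    Real.rpow_lt_rpow hy1.le (by linarith) (by linarith)
  unfold bd
  rw [e1 x hx, e1 y hy0, e2 _ hx1, e2 _ hy1]
  have hC : 0 < x ^ p1 * y ^ p1 * (1 - x) ^ q0 * (1 - y) ^ q0 := by positivity
  have i3 : x ^ (p0 - p1) * (1 - y) ^ (q1 - q0) < y ^ (p0 - p1) * (1 - x) ^ (q1 - q0) :=
    mul_lt_mul'' i1 i2 (by positivity) (by positivity)
  nlinarith [mul_lt_mul_of_pos_left i3 hC]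

lemma mlr {p0 q0 p1 q1 : ℝ} (hp1 : 0 < p1) (hp : p1 < p0) (hq0 : 0 < q0) (hq : q0 < q1)
    {t0 t1 m : ℝ} (ht1 : 0 < t1) (h10 : t1 ≤ t0) (ht0 : t0 ≤ 1)
    (h1 : ∫ x in (0:ℝ)..t1, (x - m) * bd p1 q1 x = 0)
    (h0 : ∫ x in (0:ℝ)..t0, (x - m) * bd p0 q0 x = 0) : False := by
  have hp0 : 0 < p0 := hp1.trans hp
  have hq1 : 0 < q1 := hq0.trans hq
  have c1 := bd_cont hp1 hq1
  have c0 := bd_cont hp0 hq0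
  have hm0 : 0 < m := by
    by_contra hm
    have : 0 < ∫ x in (0:ℝ)..t1, (x - m) * bd p1 q1 x :=
      intervalIntegral.intervalIntegral_pos_of_pos_on
        (Continuous.intervalIntegrable (by fun_prop) _ _)
        (fun x hx => mul_pos (by linarith [hx.1]) (bd_pos _ _ hx.1 (by linarith [hx.2]))) ht1
    linarith
  have hm1 : m < t1 := by
    by_contra hm
    have : 0 < ∫ x in (0:ℝ)..t1, -((x - m) * bd p1 q1 x) :=
      intervalIntegral.intervalIntegral_pos_of_pos_on
        (Continuous.intervalIntegrable (by fun_prop) _ _)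
        (fun x hx => by
          have := mul_pos (show 0 < m - x by linarith [hx.2])
            (bd_pos p1 q1 hx.1 (by linarith [hx.2]))
          linarith) ht1
    rw [intervalIntegral.integral_neg] at this
    linarith
  have hbm : 0 < bd p1 q1 m := bd_pos _ _ hm0 (by linarith)
  have nn : ∀ x, 0 < x → x < 1 → x ≠ m →
      0 < (x - m) * (bd p0 q0 x * bd p1 q1 m - bd p0 q0 m * bd p1 q1 x) := by
    intro x hx hx1 hxm
    rcases lt_or_gt_of_ne hxm with h | h
    · have := bd_ratio hp hq hx h (by linarith)
      exact mul_pos_of_neg_of_neg (by linarith) (by linarith)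
    · have := bd_ratio hp hq hm0 h hx1
      exact mul_pos (by linarith) (by linarith)
  have ii : ∀ a b : ℝ, IntervalIntegrable
      (fun x => (x - m) * (bd p0 q0 x * bd p1 q1 m - bd p0 q0 m * bd p1 q1 x)) volume a b :=
    fun a b => Continuous.intervalIntegrable (by fun_prop) _ _
  have A : 0 < ∫ x in (0:ℝ)..m,
      (x - m) * (bd p0 q0 x * bd p1 q1 m - bd p0 q0 m * bd p1 q1 x) :=
    intervalIntegral.intervalIntegral_pos_of_pos_on (ii _ _)
      (fun x hx => nn x hx.1 (by linarith [hx.2]) hx.2.ne) hm0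
  have B : 0 < ∫ x in m..t1,
      (x - m) * (bd p0 q0 x * bd p1 q1 m - bd p0 q0 m * bd p1 q1 x) :=
    intervalIntegral.intervalIntegral_pos_of_pos_on (ii _ _)
      (fun x hx => nn x (by linarith [hx.1]) (by linarith [hx.2]) hx.1.ne') hm1
  have AB := intervalIntegral.integral_add_adjacent_intervals (ii 0 m) (ii m t1)
  have i0 : ∀ a b : ℝ, IntervalIntegrable (fun x => (x - m) * bd p0 q0 x) volume a b :=
    fun a b => Continuous.intervalIntegrable (by fun_prop) _ _
  have i1 : ∀ a b : ℝ, IntervalIntegrable (fun x => (x - m) * bd p1 q1 x) volume a b :=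
    fun a b => Continuous.intervalIntegrable (by fun_prop) _ _
  have E : ∫ x in (0:ℝ)..t1,
      (x - m) * (bd p0 q0 x * bd p1 q1 m - bd p0 q0 m * bd p1 q1 x)
      = bd p1 q1 m * (∫ x in (0:ℝ)..t1, (x - m) * bd p0 q0 x)
        - bd p0 q0 m * ∫ x in (0:ℝ)..t1, (x - m) * bd p1 q1 x := by
    rw [← intervalIntegral.integral_const_mul, ← intervalIntegral.integral_const_mul,
      ← intervalIntegral.integral_sub ((i0 _ _).const_mul _) ((i1 _ _).const_mul _)]
    congr 1; ext x; ring
  have C : 0 ≤ ∫ x in t1..t0, (x - m) * bd p0 q0 x :=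
    intervalIntegral.integral_nonneg h10 (fun x hx => mul_nonneg (by linarith [hx.1])
      (mul_nonneg (Real.rpow_nonneg (by linarith [hx.1]) _)
        (Real.rpow_nonneg (by linarith [hx.2]) _)))
  have D := intervalIntegral.integral_add_adjacent_intervals (i0 0 t1) (i0 t1 t0)
  rw [h1, mul_zero, sub_zero] at E
  have : 0 < ∫ x in (0:ℝ)..t1, (x - m) * bd p0 q0 x := by
    have : 0 < bd p1 q1 m * (∫ x in (0:ℝ)..t1, (x - m) * bd p0 q0 x) := by linarith
    exact (mul_pos_iff_of_pos_left hbm).1 this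
  linarith

section group
variable {𝒳 : Type*} [MeasurableSpace 𝒳]

lemma mass_lt {ν : Measure 𝒳} {r : 𝒳 → ℝ} {c p q : ℝ}
    (hb : ∀ s : Set ℝ, MeasurableSet s → (ν (r ⁻¹' s)).toReal
      = c * ∫ x in s ∩ Set.Ioo (0 : ℝ) 1, bd p q x) {t : ℝ} (h0 : 0 ≤ t) (h1 : t ≤ 1) :
    (ν (r ⁻¹' Set.Iio t)).toReal = c * ∫ x in (0:ℝ)..t, bd p q x := by
  rw [hb _ measurableSet_Iio, intervalIntegral.integral_of_le h0, integral_Ioc_eq_integral_Ioo]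
  have : Set.Iio t ∩ Set.Ioo (0:ℝ) 1 = Set.Ioo 0 t := by
    ext x; simp only [Set.mem_inter_iff, Set.mem_Iio, Set.mem_Ioo]
    constructor
    · rintro ⟨a, b, _⟩; exact ⟨b, a⟩
    · rintro ⟨a, b⟩; exact ⟨b, a, by linarith⟩
  rw [this]

lemma map_eq {ν : Measure 𝒳} [IsFiniteMeasure ν] {r : 𝒳 → ℝ} (hr : Measurable r) {c p q : ℝ}
    (hc : 0 < c) (hp : 0 < p) (hq : 0 < q)
    (hb : ∀ s : Set ℝ, MeasurableSet s → (ν (r ⁻¹' s)).toReal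
      = c * ∫ x in s ∩ Set.Ioo (0 : ℝ) 1, bd p q x) :
    ν.map r = (volume.restrict (Set.Ioo (0:ℝ) 1)).withDensity
      (fun x => ENNReal.ofReal (c * bd p q x)) := by
  ext s hs
  rw [Measure.map_apply hr hs, withDensity_apply _ hs, Measure.restrict_restrict hs,
    ← ofReal_integral_eq_lintegral_ofReal, integral_const_mul, ← hb s hs,
    ENNReal.ofReal_toReal (measure_ne_top _ _)]
  · have : Continuous (fun x => c * bd p q x) := continuous_const.mul (bd_cont hp hq)
    exact (this.integrableOn_Icc (a := 0) (b := 1)).mono_set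
      (Set.inter_subset_right.trans Set.Ioo_subset_Icc_self)
  · rw [Filter.EventuallyLE, ae_restrict_iff' (hs.inter measurableSet_Ioo)]
    exact Filter.Eventually.of_forall (fun x hx => mul_nonneg hc.le (bd_pos _ _ hx.2.1 hx.2.2).le)

lemma int_lt {ν : Measure 𝒳} [IsFiniteMeasure ν] {r : 𝒳 → ℝ} (hr : Measurable r) {c p q : ℝ}
    (hc : 0 < c) (hp : 0 < p) (hq : 0 < q)
    (hb : ∀ s : Set ℝ, MeasurableSet s → (ν (r ⁻¹' s)).toReal
      = c * ∫ x in s ∩ Set.Ioo (0 : ℝ) 1, bd p q x) {t : ℝ} (h0 : 0 ≤ t) (h1 : t ≤ 1) :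
    ∫ x, (r ⁻¹' Set.Iio t).indicator r x ∂ν = c * ∫ x in (0:ℝ)..t, x * bd p q x := by
  have e : ∀ x, (r ⁻¹' Set.Iio t).indicator r x = (Set.Iio t).indicator id (r x) := by
    intro x; simp [Set.indicator]
  simp_rw [e]
  have hms : Measurable ((Set.Iio t).indicator (id : ℝ → ℝ)) :=
    measurable_id.indicator measurableSet_Iio
  rw [← integral_map (φ := r) hr.aemeasurable hms.aestronglyMeasurable,
    map_eq hr hc hp hq hb]
  have cc : Continuous (fun x => c * bd p q x) := continuous_const.mul (bd_cont hp hq)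
  rw [integral_withDensity_eq_integral_toReal_smul
    (cc.measurable.ennreal_ofReal) (by simp)]
  have : ∀ x ∈ Set.Ioo (0:ℝ) 1, (ENNReal.ofReal (c * bd p q x)).toReal •
      (Set.Iio t).indicator id x = (Set.Iio t).indicator (fun x => c * (x * bd p q x)) x := by
    intro x hx
    rw [ENNReal.toReal_ofReal (mul_nonneg hc.le (bd_pos _ _ hx.1 hx.2).le)]
    by_cases h : x ∈ Set.Iio t
    · simp only [Set.indicator_of_mem h, id, smul_eq_mul]; ring
    · simp [Set.indicator_of_notMem h]
  rw [setIntegral_congr_fun measurableSet_Ioo this, integral_indicator measurableSet_Iio,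
    Measure.restrict_restrict measurableSet_Iio, integral_const_mul,
    intervalIntegral.integral_of_le h0, integral_Ioc_eq_integral_Ioo]
  have : Set.Iio t ∩ Set.Ioo (0:ℝ) 1 = Set.Ioo 0 t := by
    ext x; simp only [Set.mem_inter_iff, Set.mem_Iio, Set.mem_Ioo]
    constructor
    · rintro ⟨a, b, _⟩; exact ⟨b, a⟩
    · rintro ⟨a, b⟩; exact ⟨b, a, by linarith⟩
  rw [this]

lemma bdd_int {ν : Measure 𝒳} [IsFiniteMeasure ν] {g : 𝒳 → ℝ} (hg : Measurable g) (C : ℝ)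
    (h : ∀ x, |g x| ≤ C) : Integrable g ν :=
  Integrable.of_bound hg.aestronglyMeasurable C (Filter.Eventually.of_forall h)

/-- the indicator of `r < t` -/
noncomputable def lo (r : 𝒳 → ℝ) (t : ℝ) (x : 𝒳) : ℝ := (r ⁻¹' Set.Iio t).indicator (fun _ => 1) x

lemma lo_meas {r : 𝒳 → ℝ} (hr : Measurable r) (t : ℝ) : Measurable (lo r t) :=
  measurable_const.indicator (hr measurableSet_Iio)

lemma lo_mem (r : 𝒳 → ℝ) (t : ℝ) (x : 𝒳) : lo r t x ∈ Set.Icc (0:ℝ) 1 := by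
  unfold lo Set.indicator; split_ifs <;> simp

lemma lo_int {ν : Measure 𝒳} [IsFiniteMeasure ν] {r : 𝒳 → ℝ} (hr : Measurable r) {c p q : ℝ}
    (hb : ∀ s : Set ℝ, MeasurableSet s → (ν (r ⁻¹' s)).toReal
      = c * ∫ x in s ∩ Set.Ioo (0 : ℝ) 1, bd p q x) {t : ℝ} (h0 : 0 ≤ t) (h1 : t ≤ 1) :
    ∫ x, lo r t x ∂ν = c * ∫ x in (0:ℝ)..t, bd p q x := by
  unfold lo
  rw [integral_indicator (hr measurableSet_Iio)]
  simp only [integral_const, smul_eq_mul, mul_one]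
  rw [← mass_lt hb h0 h1]
  simp [Measure.real]

lemma lo_int_r {ν : Measure 𝒳} [IsFiniteMeasure ν] {r : 𝒳 → ℝ} (hr : Measurable r) {c p q : ℝ}
    (hc : 0 < c) (hp : 0 < p) (hq : 0 < q)
    (hb : ∀ s : Set ℝ, MeasurableSet s → (ν (r ⁻¹' s)).toReal
      = c * ∫ x in s ∩ Set.Ioo (0 : ℝ) 1, bd p q x) {t : ℝ} (h0 : 0 ≤ t) (h1 : t ≤ 1) :
    ∫ x, lo r t x * r x ∂ν = c * ∫ x in (0:ℝ)..t, x * bd p q x := by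
  rw [← int_lt hr hc hp hq hb h0 h1]
  congr 1; ext x; unfold lo Set.indicator; split_ifs <;> simp

lemma prod_int {ν : Measure 𝒳} [IsFiniteMeasure ν] {r e : 𝒳 → ℝ} (hr : Measurable r)
    (hr01 : ∀ x, r x ∈ Set.Icc (0 : ℝ) 1) (he : Measurable e)
    (he01 : ∀ x, e x ∈ Set.Icc (0 : ℝ) 1) : Integrable (fun x => e x * r x) ν := by
  refine bdd_int (by fun_prop) 1 (fun x => ?_)
  have h1 := hr01 x; have h2 := he01 x
  rw [abs_of_nonneg (mul_nonneg h2.1 h1.1)]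
  exact mul_le_one₀ h2.2 h1.1 h1.2

lemma e_int {ν : Measure 𝒳} [IsFiniteMeasure ν] {e : 𝒳 → ℝ} (he : Measurable e)
    (he01 : ∀ x, e x ∈ Set.Icc (0 : ℝ) 1) : Integrable e ν := by
  refine bdd_int he 1 (fun x => ?_)
  rw [abs_of_nonneg (he01 x).1]; exact (he01 x).2

/-- threshold existence -/
lemma thr {ν : Measure 𝒳} [IsFiniteMeasure ν] {r e : 𝒳 → ℝ} (hr : Measurable r)
    (hr01 : ∀ x, r x ∈ Set.Icc (0 : ℝ) 1) (he : Measurable e)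
    (he01 : ∀ x, e x ∈ Set.Icc (0 : ℝ) 1) {c p q : ℝ} (hp : 0 < p) (hq : 0 < q)
    (hb : ∀ s : Set ℝ, MeasurableSet s → (ν (r ⁻¹' s)).toReal
      = c * ∫ x in s ∩ Set.Ioo (0 : ℝ) 1, bd p q x)
    (hR : 0 < ∫ x, e x ∂ν) :
    ∃ t, 0 < t ∧ t ≤ 1 ∧ ∫ x, lo r t x ∂ν = ∫ x, e x ∂ν ∧
      ∫ x, lo r t x * r x ∂ν ≤ ∫ x, e x * r x ∂ν := by
  have hcont : Continuous (fun t => c * ∫ x in (0:ℝ)..t, bd p q x) :=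
    continuous_const.mul (intervalIntegral.continuous_primitive
      (fun a b => (bd_cont hp hq).intervalIntegrable a b) 0)
  have hle : ∫ x, e x ∂ν ≤ c * ∫ x in (0:ℝ)..1, bd p q x := by
    have h1 : c * ∫ x in (0:ℝ)..1, bd p q x = (ν Set.univ).toReal := by
      have := hb Set.univ MeasurableSet.univ
      rw [Set.preimage_univ, Set.univ_inter] at this
      rw [this, intervalIntegral.integral_of_le zero_le_one, integral_Ioc_eq_integral_Ioo]
    rw [h1]
    calc ∫ x, e x ∂ν ≤ ∫ x, (1:ℝ) ∂ν :=
          integral_mono (e_int he he01) (integrable_const _) (fun x => (he01 x).2)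
      _ = _ := by simp [Measure.real]
  obtain ⟨t, ht, hte⟩ := intermediate_value_Icc (zero_le_one' ℝ) hcont.continuousOn
    (show (∫ x, e x ∂ν) ∈ _ from ⟨by simpa using hR.le, hle⟩)
  have ht0 : 0 < t := by
    rcases ht.1.lt_or_eq with h | h
    · exact h
    · subst h; simp at hte; linarith
  have hF : ∫ x, lo r t x ∂ν = ∫ x, e x ∂ν := by rw [lo_int hr hb ht.1 ht.2]; exact hte
  refine ⟨t, ht0, ht.2, hF, ?_⟩
  have hl := lo_meas hr t
  have hl01 := lo_mem r t
  have key : 0 ≤ ∫ x, ((e x * r x - lo r t x * r x) - t * (e x - lo r t x)) ∂ν := by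
    refine integral_nonneg (fun x => ?_)
    show 0 ≤ (e x * r x - lo r t x * r x) - t * (e x - lo r t x)
    have h : (e x * r x - lo r t x * r x) - t * (e x - lo r t x)
      = (e x - lo r t x) * (r x - t) := by ring
    rw [h]
    by_cases hx : r x < t
    · have : lo r t x = 1 := by simp [lo, hx]
      rw [this]
      exact mul_nonneg_of_nonpos_of_nonpos (by linarith [(he01 x).2]) (by linarith)
    · have : lo r t x = 0 := by simp [lo]; linarith
      rw [this]
      exact mul_nonneg (by linarith [(he01 x).1]) (by linarith)
  have k1 : Integrable (fun x => e x * r x - lo r t x * r x) ν :=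
    (prod_int hr hr01 he he01).sub (prod_int hr hr01 hl hl01)
  have k2 : Integrable (fun x => t * (e x - lo r t x)) ν :=
    ((e_int he he01).sub (e_int hl hl01)).const_mul t
  rw [integral_sub k1 k2,
    integral_sub (prod_int hr hr01 he he01) (prod_int hr hr01 hl hl01), integral_const_mul,
    integral_sub (e_int he he01) (e_int hl hl01), hF] at key
  linarith

lemma comb_int {ν : Measure 𝒳} [IsFiniteMeasure ν] {r : 𝒳 → ℝ} (hr : Measurable r)
    (hr01 : ∀ x, r x ∈ Set.Icc (0 : ℝ) 1) (w s t : ℝ) :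
    ∫ x, ((1 - w) * lo r t x + w * lo r s x) ∂ν
      = (∫ x, lo r t x ∂ν) + w * ((∫ x, lo r s x ∂ν) - ∫ x, lo r t x ∂ν) ∧
    ∫ x, ((1 - w) * lo r t x + w * lo r s x) * r x ∂ν
      = (∫ x, lo r t x * r x ∂ν)
        + w * ((∫ x, lo r s x * r x ∂ν) - ∫ x, lo r t x * r x ∂ν) := by
  constructor
  · rw [integral_add ((e_int (lo_meas hr t) (lo_mem r t)).const_mul _)
      ((e_int (lo_meas hr s) (lo_mem r s)).const_mul _), integral_const_mul, integral_const_mul]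
    ring
  · have : ∀ x, ((1 - w) * lo r t x + w * lo r s x) * r x
        = (1 - w) * (lo r t x * r x) + w * (lo r s x * r x) := fun x => by ring
    simp_rw [this]
    rw [integral_add ((prod_int hr hr01 (lo_meas hr t) (lo_mem r t)).const_mul _)
      ((prod_int hr hr01 (lo_meas hr s) (lo_mem r s)).const_mul _), integral_const_mul,
      integral_const_mul]
    ring

lemma bd_slice {p q : ℝ} (hp : 0 < p) (hq : 0 < q) {s t : ℝ} (hs : 0 ≤ s) (hst : s ≤ t)
    (ht : t ≤ 1) :
    s * (∫ x in s..t, bd p q x) ≤ ∫ x in s..t, x * bd p q x ∧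
    ∫ x in s..t, x * bd p q x ≤ t * ∫ x in s..t, bd p q x := by
  have c := bd_cont hp hq
  have nn : ∀ x ∈ Set.Icc s t, 0 ≤ bd p q x := fun x hx =>
    mul_nonneg (Real.rpow_nonneg (by linarith [hx.1]) _) (Real.rpow_nonneg (by linarith [hx.2]) _)
  rw [← intervalIntegral.integral_const_mul, ← intervalIntegral.integral_const_mul]
  constructor
  · exact intervalIntegral.integral_mono_on hst
      (Continuous.intervalIntegrable (by fun_prop) _ _)
      (Continuous.intervalIntegrable (by fun_prop) _ _)
      (fun x hx => mul_le_mul_of_nonneg_right hx.1 (nn x hx))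
  · exact intervalIntegral.integral_mono_on hst
      (Continuous.intervalIntegrable (by fun_prop) _ _)
      (Continuous.intervalIntegrable (by fun_prop) _ _)
      (fun x hx => mul_le_mul_of_nonneg_right hx.2 (nn x hx))

lemma arith {w0 w1 s0 s1 A B C D : ℝ} (P0 : 0 < w0) (P1 : 0 < w1) (h : s0 < s1)
    (E0 : A - B ≤ s0 * w0) (E1 : C - D ≤ -(s1 * w1)) :
    B + w1 * (A - B) + (D + w0 * (C - D)) < B + D := by
  have h1 := mul_le_mul_of_nonneg_left E0 P1.le
  have h2 := mul_le_mul_of_nonneg_left E1 P0.le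
  have h3 := mul_pos (mul_pos P0 P1) (sub_pos.2 h)
  nlinarith

lemma core {ν0 ν1 : Measure 𝒳} [IsFiniteMeasure ν0] [IsFiniteMeasure ν1]
    (hν0 : (ν0 Set.univ).toReal ≤ 1) (hν1 : (ν1 Set.univ).toReal ≤ 1)
    {r e : 𝒳 → ℝ} (hr : Measurable r)
    (hr01 : ∀ x, r x ∈ Set.Icc (0 : ℝ) 1) (he : Measurable e)
    (he01 : ∀ x, e x ∈ Set.Icc (0 : ℝ) 1) {c0 p0 q0 c1 p1 q1 : ℝ}
    (hc0 : 0 < c0) (hc1 : 0 < c1)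
    (hp1 : 0 < p1) (hp : p1 < p0) (hq0 : 0 < q0) (hq : q0 < q1)
    (hb0 : ∀ s : Set ℝ, MeasurableSet s → (ν0 (r ⁻¹' s)).toReal
      = c0 * ∫ x in s ∩ Set.Ioo (0 : ℝ) 1, bd p0 q0 x)
    (hb1 : ∀ s : Set ℝ, MeasurableSet s → (ν1 (r ⁻¹' s)).toReal
      = c1 * ∫ x in s ∩ Set.Ioo (0 : ℝ) 1, bd p1 q1 x)
    (hR0 : 0 < ∫ x, e x ∂ν0) (hR1 : 0 < ∫ x, e x ∂ν1)
    (hpar : (∫ x, e x * r x ∂ν0) / (∫ x, e x ∂ν0) = (∫ x, e x * r x ∂ν1) / (∫ x, e x ∂ν1)) :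
    ∃ e0 e1 : 𝒳 → ℝ, Measurable e0 ∧ Measurable e1 ∧ (∀ x, e0 x ∈ Set.Icc (0 : ℝ) 1) ∧
      (∀ x, e1 x ∈ Set.Icc (0 : ℝ) 1) ∧
      (∫ x, e x ∂ν0) + (∫ x, e x ∂ν1) ≤ (∫ x, e0 x ∂ν0) + (∫ x, e1 x ∂ν1) ∧
      (∫ x, e1 x ∂ν1) ≤ (∫ x, e x ∂ν1) ∧
      (∫ x, e0 x * r x ∂ν0) + (∫ x, e1 x * r x ∂ν1)
        < (∫ x, e x * r x ∂ν0) + (∫ x, e x * r x ∂ν1) := by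
  have hp0 : 0 < p0 := hp1.trans hp
  have hq1 : 0 < q1 := hq0.trans hq
  obtain ⟨t0, t0p, t0l, F0, K0⟩ := thr hr hr01 he he01 hp0 hq0 hb0 hR0
  obtain ⟨t1, t1p, t1l, F1, K1⟩ := thr hr hr01 he he01 hp1 hq1 hb1 hR1
  rcases lt_or_ge ((∫ x, lo r t0 x * r x ∂ν0) + (∫ x, lo r t1 x * r x ∂ν1))
    ((∫ x, e x * r x ∂ν0) + (∫ x, e x * r x ∂ν1)) with hlt | hge
  · exact ⟨lo r t0, lo r t1, lo_meas hr _, lo_meas hr _, lo_mem r _, lo_mem r _,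
      by rw [F0, F1], F1.le, hlt⟩
  have G0 : ∫ x, lo r t0 x * r x ∂ν0 = ∫ x, e x * r x ∂ν0 := by linarith
  have G1 : ∫ x, lo r t1 x * r x ∂ν1 = ∫ x, e x * r x ∂ν1 := by linarith
  have cb0 := bd_cont hp0 hq0
  have cb1 := bd_cont hp1 hq1
  have i0 : ∀ a b, IntervalIntegrable (bd p0 q0) volume a b := fun a b => cb0.intervalIntegrable _ _
  have i1 : ∀ a b, IntervalIntegrable (bd p1 q1) volume a b := fun a b => cb1.intervalIntegrable _ _
  have j0 : ∀ a b, IntervalIntegrable (fun x => x * bd p0 q0 x) volume a b :=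
    fun a b => Continuous.intervalIntegrable (by fun_prop) _ _
  have j1 : ∀ a b, IntervalIntegrable (fun x => x * bd p1 q1 x) volume a b :=
    fun a b => Continuous.intervalIntegrable (by fun_prop) _ _
  have htt : t0 < t1 := by
    by_contra hcon
    push Not at hcon
    set m := (∫ x, e x * r x ∂ν0) / (∫ x, e x ∂ν0) with hm
    have m0 : (∫ x, e x * r x ∂ν0) = m * ∫ x, e x ∂ν0 := by rw [hm]; field_simp
    have m1 : (∫ x, e x * r x ∂ν1) = m * ∫ x, e x ∂ν1 := by rw [hpar]; field_simp
    rw [← G0, ← F0, lo_int_r hr hc0 hp0 hq0 hb0 t0p.le t0l, lo_int hr hb0 t0p.le t0l] at m0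
    rw [← G1, ← F1, lo_int_r hr hc1 hp1 hq1 hb1 t1p.le t1l, lo_int hr hb1 t1p.le t1l] at m1
    refine mlr (m := m) hp1 hp hq0 hq t1p hcon t0l ?_ ?_
    · simp_rw [sub_mul]
      rw [intervalIntegral.integral_sub (j1 _ _) ((i1 _ _).const_mul _),
        intervalIntegral.integral_const_mul]
      have : c1 * ((∫ x in (0:ℝ)..t1, x * bd p1 q1 x) - m * ∫ x in (0:ℝ)..t1, bd p1 q1 x) = 0 := by
        linarith
      exact (mul_eq_zero.1 this).resolve_left hc1.ne'
    · simp_rw [sub_mul]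
      rw [intervalIntegral.integral_sub (j0 _ _) ((i0 _ _).const_mul _),
        intervalIntegral.integral_const_mul]
      have : c0 * ((∫ x in (0:ℝ)..t0, x * bd p0 q0 x) - m * ∫ x in (0:ℝ)..t0, bd p0 q0 x) = 0 := by
        linarith
      exact (mul_eq_zero.1 this).resolve_left hc0.ne'
  obtain ⟨s0, hs0, hs0'⟩ := exists_between htt
  obtain ⟨s1, hs1, hs1'⟩ := exists_between hs0'
  have mass_le : ∀ (ν : Measure 𝒳) [IsFiniteMeasure ν], (ν Set.univ).toReal ≤ 1 → ∀ t,
      ∫ x, lo r t x ∂ν ≤ 1 := by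
    intro ν _ h t
    calc ∫ x, lo r t x ∂ν ≤ ∫ x, (1:ℝ) ∂ν :=
          integral_mono (e_int (lo_meas hr t) (lo_mem r t)) (integrable_const _)
            (fun x => (lo_mem r t x).2)
      _ = (ν Set.univ).toReal := by simp [Measure.real]
      _ ≤ 1 := h
  have L0s := lo_int hr hb0 (t := s0) (by linarith) (by linarith)
  have L0t := lo_int hr hb0 (t := t0) (by linarith) (by linarith)
  have L1s := lo_int hr hb1 (t := s1) (by linarith) (by linarith)
  have L1t := lo_int hr hb1 (t := t1) (by linarith) (by linarith)
  have M0s := lo_int_r hr hc0 hp0 hq0 hb0 (t := s0) (by linarith) (by linarith)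
  have M0t := lo_int_r hr hc0 hp0 hq0 hb0 (t := t0) (by linarith) (by linarith)
  have M1s := lo_int_r hr hc1 hp1 hq1 hb1 (t := s1) (by linarith) (by linarith)
  have M1t := lo_int_r hr hc1 hp1 hq1 hb1 (t := t1) (by linarith) (by linarith)
  have a0 := intervalIntegral.integral_add_adjacent_intervals (i0 0 t0) (i0 t0 s0)
  have a1 := intervalIntegral.integral_add_adjacent_intervals (i1 0 s1) (i1 s1 t1)
  have b0 := intervalIntegral.integral_add_adjacent_intervals (j0 0 t0) (j0 t0 s0)
  have b1 := intervalIntegral.integral_add_adjacent_intervals (j1 0 s1) (j1 s1 t1)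
  have P0 := mul_pos hc0 (bd_int_pos hp0 hq0 t0p.le hs0 (by linarith))
  have P1 := mul_pos hc1 (bd_int_pos hp1 hq1 (by linarith) hs1' t1l)
  have Q0 := mul_le_mul_of_nonneg_left (bd_slice hp0 hq0 t0p.le hs0.le (by linarith)).2 hc0.le
  have Q1 := mul_le_mul_of_nonneg_left
    (bd_slice hp1 hq1 (by linarith) hs1'.le t1l).1 hc1.le
  have N0 := mass_le ν0 hν0 s0
  have N1 := mass_le ν1 hν1 t1
  have Z0 : 0 ≤ ∫ x, lo r t0 x ∂ν0 := integral_nonneg (fun x => (lo_mem r _ x).1)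
  have Z1 : 0 ≤ ∫ x, lo r s1 x ∂ν1 := integral_nonneg (fun x => (lo_mem r _ x).1)
  obtain ⟨w0, hw0⟩ : ∃ w, w = c0 * ∫ x in t0..s0, bd p0 q0 x := ⟨_, rfl⟩
  obtain ⟨w1, hw1⟩ : ∃ w, w = c1 * ∫ x in s1..t1, bd p1 q1 x := ⟨_, rfl⟩
  have D0 : (∫ x, lo r s0 x ∂ν0) - ∫ x, lo r t0 x ∂ν0 = w0 := by
    rw [L0s, L0t, hw0, ← a0]; ring
  have D1 : (∫ x, lo r s1 x ∂ν1) - ∫ x, lo r t1 x ∂ν1 = -w1 := by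
    rw [L1s, L1t, hw1, ← a1]; ring
  have E0 : (∫ x, lo r s0 x * r x ∂ν0) - ∫ x, lo r t0 x * r x ∂ν0 ≤ s0 * w0 := by
    rw [M0s, M0t, hw0, ← b0]; linarith
  have E1 : (∫ x, lo r s1 x * r x ∂ν1) - ∫ x, lo r t1 x * r x ∂ν1 ≤ -(s1 * w1) := by
    rw [M1s, M1t, hw1, ← b1]; linarith
  rw [← hw0] at P0
  rw [← hw1] at P1
  have cm : ∀ w s t : ℝ, 0 ≤ w → w ≤ 1 → ∀ x,
      (1 - w) * lo r t x + w * lo r s x ∈ Set.Icc (0:ℝ) 1 := by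
    intro w s t h0 h1 x
    have A := lo_mem r t x
    have B := lo_mem r s x
    constructor
    · exact add_nonneg (mul_nonneg (by linarith) A.1) (mul_nonneg h0 B.1)
    · have := mul_le_mul_of_nonneg_left A.2 (sub_nonneg.2 h1)
      have := mul_le_mul_of_nonneg_left B.2 h0
      linarith
  have cme : ∀ w s t : ℝ, Measurable (fun x => (1 - w) * lo r t x + w * lo r s x) :=
    fun w s t => ((lo_meas hr t).const_mul _).add ((lo_meas hr s).const_mul _)
  refine ⟨fun x => (1 - w1) * lo r t0 x + w1 * lo r s0 x,
    fun x => (1 - w0) * lo r t1 x + w0 * lo r s1 x, cme _ _ _, cme _ _ _,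
    cm _ _ _ P1.le (by linarith), cm _ _ _ P0.le (by linarith), ?_, ?_, ?_⟩
  · rw [(comb_int hr hr01 _ _ _).1, (comb_int hr hr01 _ _ _).1, D0, D1, F0, F1]; linarith
  · rw [(comb_int hr hr01 _ _ _).1, D1, F1]
    have := mul_pos P0 P1
    linarith
  · rw [(comb_int hr hr01 _ _ _).2, (comb_int hr hr01 _ _ _).2, ← G0, ← G1]
    exact arith P0 P1 hs1 E0 E1

end group

/-- Integrating out the independent randomisation. -/
lemma randomize {Ω 𝒳 : Type*} [MeasurableSpace Ω] [MeasurableSpace 𝒳]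
    (P : Measure Ω) [IsProbabilityMeasure P]
    (X : Ω → 𝒳) (hX : Measurable X) (U : Ω → ℝ) (hU : Measurable U)
    (hUunif : Measure.map U P = volume.restrict (Set.Icc (0 : ℝ) 1))
    (hindep : ProbabilityTheory.IndepFun U X P)
    (d : 𝒳 → ℝ) (hd : Measurable d) (hd01 : ∀ x, d x ∈ Set.Icc (0 : ℝ) 1)
    (G : Set 𝒳) (hG : MeasurableSet G) (g : 𝒳 → ℝ) (hg : Measurable g)
    (hg1 : ∀ x, |g x| ≤ 1) :
    ∫ ω in {ω | ¬ U ω ≤ d (X ω)} ∩ X ⁻¹' G, g (X ω) ∂P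
      = ∫ x in G, (1 - d x) * g x ∂(P.map X) := by
  have hlaw := (ProbabilityTheory.indepFun_iff_map_prod_eq_prod_map_map
    hU.aemeasurable hX.aemeasurable).1 hindep
  have : IsProbabilityMeasure (P.map X) := Measure.isProbabilityMeasure_map hX.aemeasurable
  have : IsProbabilityMeasure (P.map U) := Measure.isProbabilityMeasure_map hU.aemeasurable
  let T : Set (ℝ × 𝒳) := {z | d z.2 < z.1} ∩ Prod.snd ⁻¹' G
  have hT : MeasurableSet T :=
    (measurableSet_lt (hd.comp measurable_snd) measurable_fst).inter (measurable_snd hG)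
  have hS : {ω | ¬ U ω ≤ d (X ω)} ∩ X ⁻¹' G = (fun ω => (U ω, X ω)) ⁻¹' T := by
    ext ω; simp [T]
  have hm : Measurable (fun z : ℝ × 𝒳 => T.indicator (fun z => g z.2) z) :=
    (hg.comp measurable_snd).indicator hT
  rw [hS, ← integral_indicator ((hU.prodMk hX) hT)]
  have e : ∀ ω, ((fun ω => (U ω, X ω)) ⁻¹' T).indicator (fun ω => g (X ω)) ω
      = T.indicator (fun z => g z.2) (U ω, X ω) := fun ω => by
    unfold Set.indicator; rfl
  simp_rw [e]
  rw [← integral_map (φ := fun ω => (U ω, X ω)) (hU.prodMk hX).aemeasurable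
    hm.aestronglyMeasurable, hlaw, integral_prod_symm, ← integral_indicator hG]
  · refine integral_congr_ae (Filter.Eventually.of_forall fun x => ?_)
    show ∫ u, T.indicator (fun z => g z.2) (u, x) ∂(P.map U) = G.indicator _ x
    by_cases hx : x ∈ G
    · have : ∀ u, T.indicator (fun z => g z.2) (u, x)
          = (Set.Ioi (d x)).indicator (fun _ => g x) u := fun u => by
        simp [T, Set.indicator, hx]
      simp_rw [this]
      rw [integral_indicator measurableSet_Ioi, hUunif, Measure.restrict_restrict measurableSet_Ioi]
      have : Set.Ioi (d x) ∩ Set.Icc 0 1 = Set.Ioc (d x) 1 := by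
        ext u; simp only [Set.mem_inter_iff, Set.mem_Ioi, Set.mem_Icc, Set.mem_Ioc]
        have := (hd01 x).1
        constructor
        · rintro ⟨a, b, c⟩; exact ⟨a, c⟩
        · rintro ⟨a, b⟩; exact ⟨a, by linarith, b⟩
      rw [this]
      simp [hx, Set.indicator, Measure.real, ENNReal.toReal_ofReal (sub_nonneg.2 (hd01 x).2)]
    · have : ∀ u, T.indicator (fun z => g z.2) (u, x) = 0 := fun u => by
        simp [T, Set.indicator, hx]
      simp [this, hx]
  · refine bdd_int hm 1 (fun z => ?_)
    unfold Set.indicator; split_ifs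
    · exact hg1 _
    · simp

end CPP

/-- With two groups whose conditional risk distributions are Beta with
parameters `1 < α_{a₁} < α_{a₀}` and `1 < β_{a₀} < β_{a₁}`, any feasible policy satisfying
counterfactual predictive parity (equal conditional mean risk among rejected individuals)
is strongly Pareto dominated with respect to the family `u_λ(x) = r(x) + λ·1{α(x) = a₁}`,
`λ ≥ 0`. -/
theorem counterfactual_predictive_parity_dominated
    {Ω 𝒳 𝒜 : Type*} [MeasurableSpace Ω] [MeasurableSpace 𝒳]
    [MeasurableSpace 𝒜] [MeasurableSingletonClass 𝒜] [DecidableEq 𝒜]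
    (P : Measure Ω) [IsProbabilityMeasure P]
    (X : Ω → 𝒳) (hX : Measurable X)
    (U : Ω → ℝ) (hU : Measurable U)
    -- `U` is uniform on `[0,1]` and independent of `X`
    (hUunif : Measure.map U P = volume.restrict (Set.Icc (0 : ℝ) 1))
    (hindep : ProbabilityTheory.IndepFun U X P)
    (α : 𝒳 → 𝒜) (hα : Measurable α)
    -- `𝒜 = {a₀, a₁}`, both groups of positive probability
    (a₀ a₁ : 𝒜) (hne : a₀ ≠ a₁) (hall : ∀ a, a = a₀ ∨ a = a₁)
    (hposgrp : ∀ a, 0 < P {ω | α (X ω) = a})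
    (r : 𝒳 → ℝ) (hr : Measurable r) (hr01 : ∀ x, r x ∈ Set.Icc (0 : ℝ) 1)
    -- the conditional distribution of `r(X)` given `A = a` is Beta(αa a, βa a)
    (αa βa : 𝒜 → ℝ)
    (hbeta : ∀ a, ∃ c : ℝ, 0 < c ∧ ∀ s : Set ℝ, MeasurableSet s →
      (P ({ω | r (X ω) ∈ s} ∩ {ω | α (X ω) = a})).toReal
        = c * ∫ x in s ∩ Set.Ioo (0 : ℝ) 1, x ^ (αa a - 1) * (1 - x) ^ (βa a - 1))
    (hα₁ : 1 < αa a₁) (hα₀ : αa a₁ < αa a₀)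
    (hβ₀ : 1 < βa a₀) (hβ₁ : βa a₀ < βa a₁)
    -- the budget
    (b : ℝ) (hb0 : 0 < b) (hb1 : b < 1)
    -- `d` is a feasible policy
    (d : 𝒳 → ℝ) (hd : Measurable d) (hd01 : ∀ x, d x ∈ Set.Icc (0 : ℝ) 1)
    (hfeas : ∫ ω, d (X ω) ∂P ≤ b)
    -- counterfactual predictive parity: `E[r(X) | A = a₀, D = 0] = E[r(X) | A = a₁, D = 0]`,
    -- where `D = 1{U ≤ d(X)}`
    (hcpp :
      (∫ ω in {ω | ¬ U ω ≤ d (X ω)} ∩ {ω | α (X ω) = a₀}, r (X ω) ∂P)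
          / (P ({ω | ¬ U ω ≤ d (X ω)} ∩ {ω | α (X ω) = a₀})).toReal
        = (∫ ω in {ω | ¬ U ω ≤ d (X ω)} ∩ {ω | α (X ω) = a₁}, r (X ω) ∂P)
          / (P ({ω | ¬ U ω ≤ d (X ω)} ∩ {ω | α (X ω) = a₁})).toReal) :
    -- then `d` is strongly Pareto dominated with respect to `{u_λ : λ ≥ 0}`
    ∃ d' : 𝒳 → ℝ, Measurable d' ∧ (∀ x, d' x ∈ Set.Icc (0 : ℝ) 1) ∧
      (∫ ω, d' (X ω) ∂P ≤ b) ∧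
      ∀ lam : ℝ, 0 ≤ lam →
        (∫ ω, d (X ω) * (r (X ω) + lam * (if α (X ω) = a₁ then 1 else 0)) ∂P)
          < ∫ ω, d' (X ω) * (r (X ω) + lam * (if α (X ω) = a₁ then 1 else 0)) ∂P := by
  classical
  have : IsProbabilityMeasure (P.map X) := Measure.isProbabilityMeasure_map hX.aemeasurable
  obtain ⟨Q, hQ⟩ : ∃ Q, Q = P.map X := ⟨_, rfl⟩
  rw [← hQ] at this
  have tr : ∀ g : 𝒳 → ℝ, Measurable g → ∫ ω, g (X ω) ∂P = ∫ x, g x ∂Q := fun g hg => by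
    rw [hQ, integral_map hX.aemeasurable hg.aestronglyMeasurable]
  have hG : ∀ a, MeasurableSet (α ⁻¹' {a}) := fun a => hα (measurableSet_singleton a)
  have hcompl : (α ⁻¹' {a₁})ᶜ = α ⁻¹' {a₀} := by
    ext x
    simp only [Set.mem_compl_iff, Set.mem_preimage, Set.mem_singleton_iff]
    constructor
    · intro h; exact (hall (α x)).resolve_right h
    · intro h h'; exact hne (h.symm.trans h')
  have split : ∀ g : 𝒳 → ℝ, Integrable g Q →
      ∫ x, g x ∂Q = (∫ x in α ⁻¹' {a₀}, g x ∂Q) + ∫ x in α ⁻¹' {a₁}, g x ∂Q := fun g hg => by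
    rw [← integral_add_compl (hG a₁) hg, hcompl, add_comm]
  have hb : ∀ a, ∃ c : ℝ, 0 < c ∧ ∀ s : Set ℝ, MeasurableSet s →
      ((Q.restrict (α ⁻¹' {a})) (r ⁻¹' s)).toReal
        = c * ∫ x in s ∩ Set.Ioo (0 : ℝ) 1, CPP.bd (αa a - 1) (βa a - 1) x := by
    intro a
    obtain ⟨c, hc, h⟩ := hbeta a
    refine ⟨c, hc, fun s hs => ?_⟩
    rw [Measure.restrict_apply (hr hs), hQ, Measure.map_apply hX ((hr hs).inter (hG a))]
    exact h s hs
  obtain ⟨c0, hc0, hb0'⟩ := hb a₀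
  obtain ⟨c1, hc1, hb1'⟩ := hb a₁
  have he : Measurable (fun x => 1 - d x) := measurable_const.sub hd
  have he01 : ∀ x, (fun x => 1 - d x) x ∈ Set.Icc (0:ℝ) 1 := fun x =>
    ⟨by have := (hd01 x).2; show 0 ≤ 1 - d x; linarith,
     by have := (hd01 x).1; show 1 - d x ≤ 1; linarith⟩
  -- translate parity
  have tS : ∀ a, ∫ ω in {ω | ¬ U ω ≤ d (X ω)} ∩ {ω | α (X ω) = a}, r (X ω) ∂P
      = ∫ x in α ⁻¹' {a}, (1 - d x) * r x ∂Q := fun a => by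
    rw [hQ]
    exact CPP.randomize P X hX U hU hUunif hindep d hd hd01 _ (hG a) r hr
      (fun x => by rw [abs_of_nonneg (hr01 x).1]; exact (hr01 x).2)
  have tR : ∀ a, (P ({ω | ¬ U ω ≤ d (X ω)} ∩ {ω | α (X ω) = a})).toReal
      = ∫ x in α ⁻¹' {a}, (1 - d x) ∂Q := fun a => by
    have h := CPP.randomize P X hX U hU hUunif hindep d hd hd01 _ (hG a) (fun _ => 1)
      measurable_const (fun x => by simp)
    simp only [mul_one] at h
    rw [hQ, ← h]
    simp only [integral_const, smul_eq_mul, mul_one, Measure.real,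
      Measure.restrict_apply MeasurableSet.univ, Set.univ_inter]
    rfl
  rw [tS, tS, tR, tR] at hcpp
  -- positivity of rejection masses
  have eI : Integrable (fun x => 1 - d x) Q := CPP.e_int he he01
  have hsum : 0 < (∫ x in α ⁻¹' {a₀}, (1 - d x) ∂Q) + ∫ x in α ⁻¹' {a₁}, (1 - d x) ∂Q := by
    rw [← split _ eI, integral_sub (integrable_const _) (CPP.e_int hd hd01), ← tr d hd]
    simp; linarith
  have Rnn : ∀ a, 0 ≤ ∫ x in α ⁻¹' {a}, (1 - d x) ∂Q := fun a => integral_nonneg (fun x => (he01 x).1)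
  have Spos : ∀ a, 0 < ∫ x in α ⁻¹' {a}, (1 - d x) ∂Q →
      0 < ∫ x in α ⁻¹' {a}, (1 - d x) * r x ∂Q := by
    intro a ha
    obtain ⟨c, hc, h⟩ := hb a
    have hpi : Integrable (fun x => (1 - d x) * r x) (Q.restrict (α ⁻¹' {a})) :=
      CPP.prod_int hr hr01 he he01
    have nn : 0 ≤ fun x => (1 - d x) * r x := fun x => mul_nonneg (he01 x).1 (hr01 x).1
    rcases (integral_nonneg (μ := Q.restrict (α ⁻¹' {a})) nn).lt_or_eq with h1 | h1
    · exact h1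
    exfalso
    have h2 := (integral_eq_zero_iff_of_nonneg nn hpi).1 h1.symm
    have h3 : ∀ᵐ x ∂(Q.restrict (α ⁻¹' {a})), r x ≠ 0 := by
      have := h {0} (measurableSet_singleton 0)
      have hs : ({0} : Set ℝ) ∩ Set.Ioo 0 1 = ∅ := by
        ext x; simp only [Set.mem_inter_iff, Set.mem_singleton_iff, Set.mem_Ioo,
          Set.mem_empty_iff_false, iff_false]
        rintro ⟨h, h', _⟩; linarith
      rw [hs] at this
      simp only [Measure.restrict_empty, integral_zero_measure, mul_zero] at this
      have h0 := (ENNReal.toReal_eq_zero_iff _).1 this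
      have h0 := h0.resolve_right (measure_ne_top _ _)
      rw [ae_iff]
      convert h0 using 2
      ext x; simp
    have h4 : ∫ x in α ⁻¹' {a}, (1 - d x) ∂Q = 0 := by
      rw [← integral_zero 𝒳 ℝ (μ := Q.restrict (α ⁻¹' {a}))]
      refine integral_congr_ae ?_
      filter_upwards [h2, h3] with x hx hx'
      exact (mul_eq_zero.1 hx).resolve_right hx'
    linarith
  have hR0 : 0 < ∫ x in α ⁻¹' {a₀}, (1 - d x) ∂Q := by
    rcases (Rnn a₀).lt_or_eq with h | h
    · exact h
    exfalso
    have h1 : 0 < ∫ x in α ⁻¹' {a₁}, (1 - d x) ∂Q := by linarith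
    have := div_pos (Spos a₁ h1) h1
    rw [← hcpp, ← h, div_zero] at this
    exact lt_irrefl _ this
  have hR1 : 0 < ∫ x in α ⁻¹' {a₁}, (1 - d x) ∂Q := by
    rcases (Rnn a₁).lt_or_eq with h | h
    · exact h
    exfalso
    have := div_pos (Spos a₀ hR0) hR0
    rw [hcpp, ← h, div_zero] at this
    exact lt_irrefl _ this
  have mle : ∀ a, ((Q.restrict (α ⁻¹' {a})) Set.univ).toReal ≤ 1 := fun a => by
    rw [Measure.restrict_apply MeasurableSet.univ]
    exact ENNReal.toReal_le_of_le_ofReal zero_le_one (by simpa using prob_le_one)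
  obtain ⟨e0, e1, me0, me1, e001, e101, hbud, hgrp, hrisk⟩ :=
    CPP.core (mle a₀) (mle a₁) hr hr01 he he01 hc0 hc1
      (show 0 < αa a₁ - 1 by linarith) (show αa a₁ - 1 < αa a₀ - 1 by linarith)
      (show 0 < βa a₀ - 1 by linarith) (show βa a₀ - 1 < βa a₁ - 1 by linarith)
      hb0' hb1' hR0 hR1 hcpp
  -- the dominating policy
  obtain ⟨ee, hee⟩ : ∃ ee : 𝒳 → ℝ, ee = fun x => if α x = a₁ then e1 x else e0 x := ⟨_, rfl⟩
  have mee : Measurable ee := by rw [hee]; exact Measurable.ite (hG a₁) me1 me0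
  have ee01 : ∀ x, ee x ∈ Set.Icc (0:ℝ) 1 := fun x => by
    rw [hee]; dsimp only; split_ifs
    · exact e101 x
    · exact e001 x
  have q1 : ∀ x ∈ α ⁻¹' {a₁}, ee x = e1 x := fun x hx => by
    rw [hee]; exact if_pos hx
  have q0 : ∀ x ∈ α ⁻¹' {a₀}, ee x = e0 x := fun x hx => by
    rw [hee]; exact if_neg (fun h => hne (hx.symm.trans h))
  have I1 : ∫ x in α ⁻¹' {a₁}, ee x ∂Q = ∫ x in α ⁻¹' {a₁}, e1 x ∂Q :=
    setIntegral_congr_fun (hG _) q1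
  have I0 : ∫ x in α ⁻¹' {a₀}, ee x ∂Q = ∫ x in α ⁻¹' {a₀}, e0 x ∂Q :=
    setIntegral_congr_fun (hG _) q0
  have J1 : ∫ x in α ⁻¹' {a₁}, ee x * r x ∂Q = ∫ x in α ⁻¹' {a₁}, e1 x * r x ∂Q :=
    setIntegral_congr_fun (hG _) (fun x hx => by simp only [q1 x hx])
  have J0 : ∫ x in α ⁻¹' {a₀}, ee x * r x ∂Q = ∫ x in α ⁻¹' {a₀}, e0 x * r x ∂Q :=
    setIntegral_congr_fun (hG _) (fun x hx => by simp only [q0 x hx])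
  have bud : ∫ x, (1 - d x) ∂Q ≤ ∫ x, ee x ∂Q := by
    rw [split _ eI, split _ (CPP.e_int mee ee01), I0, I1]; exact hbud
  have risk : ∫ x, ee x * r x ∂Q < ∫ x, (1 - d x) * r x ∂Q := by
    rw [split _ (CPP.prod_int hr hr01 mee ee01), split _ (CPP.prod_int hr hr01 he he01), J0, J1]
    exact hrisk
  have md' : Measurable (fun x => 1 - ee x) := measurable_const.sub mee
  refine ⟨fun x => 1 - ee x, md', fun x => ?_, ?_, fun lam hlam => ?_⟩
  · have := ee01 x
    exact ⟨by show 0 ≤ 1 - ee x; linarith [this.2], by show 1 - ee x ≤ 1; linarith [this.1]⟩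
  · rw [tr (fun x => 1 - ee x) md', integral_sub (integrable_const _) (CPP.e_int mee ee01)]
    rw [integral_sub (integrable_const _) (CPP.e_int hd hd01), ← tr d hd] at bud
    linarith
  · have util : ∀ f : 𝒳 → ℝ, Measurable f → (∀ x, f x ∈ Set.Icc (0:ℝ) 1) →
        ∫ ω, (1 - f (X ω)) * (r (X ω) + lam * (if α (X ω) = a₁ then 1 else 0)) ∂P
        = (∫ x, (r x + lam * (if α x = a₁ then 1 else 0)) ∂Q) - (∫ x, f x * r x ∂Q)
          - lam * ∫ x in α ⁻¹' {a₁}, f x ∂Q := by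
      intro f hf hf01
      have mi : Measurable (fun x => if α x = a₁ then (1:ℝ) else 0) :=
        Measurable.ite (hG a₁) measurable_const measurable_const
      have hu : Measurable (fun x => r x + lam * (if α x = a₁ then (1:ℝ) else 0)) :=
        hr.add (mi.const_mul _)
      rw [tr (fun x => (1 - f x) * (r x + lam * (if α x = a₁ then 1 else 0)))
        ((measurable_const.sub hf).mul hu)]
      have ii : Integrable (fun x => if α x = a₁ then (1:ℝ) else 0) Q :=
        CPP.e_int mi (fun x => by split_ifs <;> simp)
      have iu : Integrable (fun x => r x + lam * (if α x = a₁ then (1:ℝ) else 0)) Q :=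
        (CPP.e_int hr hr01).add (ii.const_mul _)
      have ifr : Integrable (fun x => f x * r x) Q := CPP.prod_int hr hr01 hf hf01
      have ifi : Integrable (fun x => lam * (α ⁻¹' {a₁}).indicator f x) Q :=
        ((CPP.e_int hf hf01).indicator (hG a₁)).const_mul _
      have ex : ∀ x, (1 - f x) * (r x + lam * (if α x = a₁ then 1 else 0))
          = (r x + lam * (if α x = a₁ then 1 else 0)) - f x * r x
            - lam * (α ⁻¹' {a₁}).indicator f x := fun x => by
        by_cases h : α x = a₁
        · simp [Set.indicator, h]; ring
        · simp [Set.indicator, h]; ring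
      simp_rw [ex]
      have iur : Integrable (fun x => r x + lam * (if α x = a₁ then (1:ℝ) else 0) - f x * r x) Q :=
        iu.sub ifr
      rw [integral_sub iur ifi, integral_sub iu ifr, integral_const_mul,
        integral_indicator (hG a₁)]
    have u1 := util (fun x => 1 - d x) he he01
    have u2 := util ee mee ee01
    simp only [sub_sub_cancel] at u1
    rw [u1, u2, I1]
    have := mul_le_mul_of_nonneg_left hgrp hlam
    linarith
end

section
/- Suppose 𝒜 = {a₀, a₁} with Pr(A = a) > 0 for both a, let r : 𝒳 → [0,1] be measurable, and let 𝒰 be the family of utility functions u_λ(x) = r(x) + λ·1{α(x) = a₁} indexed by λ ≥ 0. Suppose that for each a ∈ 𝒜 the conditional distribution of r(X) given A = a is the Beta distribution with mean μ_a and sample size v, i.e., Beta with shape parameters (μ_a·v, (1−μ_a)·v), where v > 2 and μ_{a₀} > μ_{a₁} > 1/v. Let U be uniform on [0,1] independent of X and D = 1{U ≤ d(X)}. Then any feasible policy d satisfying E[r(X) | A = a₀, D = 0] = E[r(X) | A = a₁, D = 0] (the condition implied by counterfactual predictive parity when r(x) = E[Y(1) | X = x] for a binary potential outcome Y(1)) is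 strongly Pareto dominated with respect to 𝒰. -/
open MeasureTheory

lemma cpp_int {Z : Type*} [MeasurableSpace Z] (Q : Measure Z) [IsFiniteMeasure Q]
    (f : Z → ℝ) (hf : Measurable f) (C : ℝ) (h : ∀ x, |f x| ≤ C) : Integrable f Q :=
  Integrable.of_bound hf.aestronglyMeasurable C (Filter.Eventually.of_forall h)

lemma cpp_lin {Z : Type*} [MeasurableSpace Z] (Q : Measure Z) (f g k : Z → ℝ) (a b : ℝ)
    (hf : Integrable f Q) (hg : Integrable g Q) (hk : Integrable k Q) :
    ∫ x, (f x + a * g x - b * k x) ∂Q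
      = ∫ x, f x ∂Q + a * ∫ x, g x ∂Q - b * ∫ x, k x ∂Q := by
  have h1 : Integrable (fun x => f x + a * g x) Q := hf.add (hg.const_mul a)
  rw [integral_sub h1 (hk.const_mul b), integral_add hf (hg.const_mul a), integral_const_mul,
    integral_const_mul]

lemma cpp_swap {Z : Type*} [MeasurableSpace Z] (Q : Measure Z) [IsProbabilityMeasure Q]
    (r d : Z → ℝ) (hr : Measurable r) (hr01 : ∀ x, r x ∈ Set.Icc (0 : ℝ) 1)
    (hd : Measurable d) (hd01 : ∀ x, d x ∈ Set.Icc (0 : ℝ) 1)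
    (S1 S T : Set Z) (hS1 : MeasurableSet S1) (hSm : MeasurableSet S) (hTm : MeasurableSet T)
    (t : ℝ) (hS : ∀ x ∈ S, t < r x ∧ x ∈ S1) (hT : ∀ x ∈ T, r x < t)
    (hmS : 0 < ∫ x in S, (1 - d x) ∂Q) (hmT : 0 < ∫ x in T, d x ∂Q) :
    ∃ d' : Z → ℝ, Measurable d' ∧ (∀ x, d' x ∈ Set.Icc (0 : ℝ) 1) ∧
      ∫ x, d' x ∂Q = ∫ x, d x ∂Q ∧ ∫ x, d x * r x ∂Q < ∫ x, d' x * r x ∂Q ∧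
      ∫ x in S1, d x ∂Q ≤ ∫ x in S1, d' x ∂Q := by
  set mS := ∫ x in S, (1 - d x) ∂Q with hmSd
  set mT := ∫ x in T, d x ∂Q with hmTd
  have hda : ∀ x, |d x| ≤ 1 := fun x => abs_le.2 ⟨by linarith [(hd01 x).1], (hd01 x).2⟩
  have hra : ∀ x, |r x| ≤ 1 := fun x => abs_le.2 ⟨by linarith [(hr01 x).1], (hr01 x).2⟩
  have hwa : ∀ x, |1 - d x| ≤ 1 :=
    fun x => abs_le.2 ⟨by linarith [(hd01 x).2], by linarith [(hd01 x).1]⟩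
  have hwm : Measurable (fun x => 1 - d x) := measurable_const.sub hd
  have hid : Integrable d Q := cpp_int Q d hd 1 hda
  have hiw : Integrable (fun x => 1 - d x) Q := cpp_int Q _ hwm 1 hwa
  have hmul : ∀ f : Z → ℝ, Measurable f → (∀ x, |f x| ≤ 1) → Integrable (fun x => f x * r x) Q := by
    intro f hf h
    refine cpp_int Q _ (hf.mul hr) 1 (fun x => ?_)
    rw [abs_mul]; exact mul_le_one₀ (h x) (abs_nonneg _) (hra x)
  have hS1' : mS ≤ 1 := by
    have h1 : mS ≤ ∫ x, (1 - d x) ∂Q :=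
      setIntegral_le_integral hiw (Filter.Eventually.of_forall fun x => by
        have := (hd01 x).2; simp only [Pi.zero_apply]; linarith)
    have h2 : ∫ x, (1 - d x) ∂Q ≤ ∫ x, (1:ℝ) ∂Q :=
      integral_mono hiw (integrable_const _) (fun x => by
        have := (hd01 x).1; simp only; linarith)
    simp at h2; linarith
  have hT1' : mT ≤ 1 := by
    have h1 : mT ≤ ∫ x, d x ∂Q :=
      setIntegral_le_integral hid (Filter.Eventually.of_forall fun x => (hd01 x).1)
    have h2 : ∫ x, d x ∂Q ≤ ∫ x, (1:ℝ) ∂Q :=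
      integral_mono hid (integrable_const _) (fun x => (hd01 x).2)
    simp at h2; linarith
  let F : Z → ℝ := S.indicator (fun x => 1 - d x)
  let G : Z → ℝ := T.indicator d
  have hFm : Measurable F := hwm.indicator hSm
  have hGm : Measurable G := hd.indicator hTm
  have hFa : ∀ x, |F x| ≤ 1 := by
    intro x
    by_cases h : x ∈ S
    · simpa [F, h] using hwa x
    · simp [F, h]
  have hGa : ∀ x, |G x| ≤ 1 := by
    intro x
    by_cases h : x ∈ T
    · simpa [G, h] using hda x
    · simp [G, h]
  have hiF : Integrable F Q := cpp_int Q F hFm 1 hFa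
  have hiG : Integrable G Q := cpp_int Q G hGm 1 hGa
  have hF : ∫ x, F x ∂Q = mS := integral_indicator hSm
  have hG : ∫ x, G x ∂Q = mT := integral_indicator hTm
  refine ⟨fun x => d x + mT * F x - mS * G x, ?_, ?_, ?_, ?_, ?_⟩
  · exact (hd.add (hFm.const_mul _)).sub (hGm.const_mul _)
  · intro x
    have h0 := (hd01 x).1
    have h1 := (hd01 x).2
    by_cases hxS : x ∈ S
    · have hxT : x ∉ T := fun h => by linarith [(hS x hxS).1, hT x h]
      simp only [F, G, hxS, hxT, Set.indicator_of_mem, Set.indicator_of_notMem,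
        not_false_eq_true, Set.mem_Icc]
      constructor <;> nlinarith
    · by_cases hxT : x ∈ T
      · simp only [F, G, hxS, hxT, Set.indicator_of_mem, Set.indicator_of_notMem,
          not_false_eq_true, Set.mem_Icc]
        constructor <;> nlinarith
      · simpa [F, G, hxS, hxT] using ⟨h0, h1⟩
  · rw [cpp_lin Q d F G mT mS hid hiF hiG, hF, hG]
    ring
  · have e : (fun x => (d x + mT * F x - mS * G x) * r x)
        = fun x => d x * r x + mT * (F x * r x) - mS * (G x * r x) := by
      funext x; ring
    have i1 := hmul d hd hda
    have i2 := hmul F hFm hFa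
    have i3 := hmul G hGm hGa
    rw [e, cpp_lin Q (fun x => d x * r x) (fun x => F x * r x) (fun x => G x * r x) mT mS i1 i2 i3]
    have hg : ∫ x, G x * r x ∂Q ≤ mT * t := by
      rw [← hG, ← integral_mul_const]
      refine integral_mono i3 (hiG.mul_const _) (fun x => ?_)
      by_cases h : x ∈ T
      · simp only [G, h, Set.indicator_of_mem]
        exact mul_le_mul_of_nonneg_left (hT x h).le (hd01 x).1
      · simp [G, h]
    have hf : mS * t < ∫ x, F x * r x ∂Q := by
      rw [← hF, ← integral_mul_const, ← sub_pos, ← integral_sub i2 (hiF.mul_const _)]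
      have hnn : 0 ≤ fun x => F x * r x - F x * t := by
        intro x
        by_cases h : x ∈ S
        · simp only [F, h, Set.indicator_of_mem, Pi.zero_apply]
          have := (hS x h).1
          have := (hd01 x).2
          nlinarith
        · simp [F, h]
      have hii := i2.sub (hiF.mul_const t)
      refine lt_of_le_of_ne (integral_nonneg hnn) (fun h0 => ?_)
      have h0' := (integral_eq_zero_iff_of_nonneg hnn hii).1 h0.symm
      have : ∫ x, F x ∂Q = 0 := by
        refine integral_eq_zero_of_ae ?_
        filter_upwards [h0'] with x hx
        by_cases h : x ∈ S
        · have h2 := (hS x h).1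
          have h3 : F x * (r x - t) = 0 := by simp only [Pi.zero_apply] at hx; linarith
          rcases mul_eq_zero.1 h3 with h4 | h4
          · exact h4
          · linarith
        · simp [F, h]
      linarith
    nlinarith
  · rw [cpp_lin (Q.restrict S1) d F G mT mS hid.integrableOn hiF.integrableOn hiG.integrableOn]
    have h1 : ∫ x in S1, F x ∂Q = mS := by
      rw [← hF]
      refine setIntegral_eq_integral_of_forall_compl_eq_zero (fun x hx => ?_)
      have : x ∉ S := fun h => hx (hS x h).2
      simp [F, this]
    have h2 : ∫ x in S1, G x ∂Q ≤ mT := by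
      rw [← hG]
      refine setIntegral_le_integral hiG (Filter.Eventually.of_forall fun x => ?_)
      exact Set.indicator_nonneg (fun y _ => (hd01 y).1) x
    rw [h1]
    nlinarith

lemma cpp_core {Z : Type*} [MeasurableSpace Z] (Q : Measure Z) [IsProbabilityMeasure Q]
    (r d : Z → ℝ) (hr : Measurable r) (hr01 : ∀ x, r x ∈ Set.Icc (0 : ℝ) 1)
    (hd : Measurable d) (hd01 : ∀ x, d x ∈ Set.Icc (0 : ℝ) 1)
    (S0 S1 : Set Z) (hS0 : MeasurableSet S0) (hS1 : MeasurableSet S1)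
    (hna : ∀ y, ∀ᵐ x ∂Q, r x ≠ y)
    (m : ℝ) (hm0 : 0 < m) (hm1 : m < 1)
    (h1 : ∫ x in S1, (r x - m) * (1 - d x) ∂Q = 0)
    (h0 : ∫ x in S0, (r x - m) * (1 - d x) ∂Q = 0)
    (hP1 : 0 < ∫ x in S1, (1 - d x) ∂Q)
    (hineq : ∀ t, m ≤ t → t ≤ 1 → ∃ K : ℝ,
      K * ∫ x in S1 ∩ {x | r x < t}, (r x - m) ∂Q < ∫ x in S0 ∩ {x | r x < t}, (r x - m) ∂Q)
    (hsw : ∀ t, ∫ x in S1 ∩ {x | t < r x}, (1 - d x) ∂Q = 0 ∨ ∫ x in {x | r x < t}, d x ∂Q = 0) :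
    False := by
  have hda : ∀ x, |d x| ≤ 1 := fun x => abs_le.2 ⟨by linarith [(hd01 x).1], (hd01 x).2⟩
  have hwa : ∀ x, |1 - d x| ≤ 1 :=
    fun x => abs_le.2 ⟨by linarith [(hd01 x).2], by linarith [(hd01 x).1]⟩
  have hwm : Measurable (fun x => 1 - d x) := measurable_const.sub hd
  have hid : Integrable d Q := cpp_int Q d hd 1 hda
  have hiw : Integrable (fun x => 1 - d x) Q := cpp_int Q _ hwm 1 hwa
  have hrma : ∀ x, |r x - m| ≤ 1 := fun x =>
    abs_le.2 ⟨by linarith [(hr01 x).1], by linarith [(hr01 x).2]⟩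
  have hrmm : Measurable (fun x => r x - m) := hr.sub_const m
  have hirm : Integrable (fun x => r x - m) Q := cpp_int Q _ hrmm 1 hrma
  have hirw : Integrable (fun x => (r x - m) * (1 - d x)) Q := by
    refine cpp_int Q _ (hrmm.mul hwm) 1 (fun x => ?_)
    rw [abs_mul]; exact mul_le_one₀ (hrma x) (abs_nonneg _) (hwa x)
  have hlt : ∀ t, MeasurableSet {x | r x < t} := fun t => measurableSet_lt hr measurable_const
  have hgt : ∀ t, MeasurableSet {x | t < r x} := fun t => measurableSet_lt measurable_const hr
  have dz : ∀ t, ∫ x in {x | r x < t}, d x ∂Q = 0 → ∀ᵐ x ∂Q, r x < t → d x = 0 := by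
    intro t ht
    have := (setIntegral_eq_zero_iff_of_nonneg_ae
      (Filter.Eventually.of_forall fun x => (hd01 x).1) hid.integrableOn).1 ht
    exact (ae_restrict_iff' (hlt t)).1 this
  have wz : ∀ t, ∫ x in S1 ∩ {x | t < r x}, (1 - d x) ∂Q = 0 →
      ∀ᵐ x ∂Q, x ∈ S1 → t < r x → 1 - d x = 0 := by
    intro t ht
    have := (setIntegral_eq_zero_iff_of_nonneg_ae
      (Filter.Eventually.of_forall fun x => by
        simp only [Pi.zero_apply]; linarith [(hd01 x).2]) hiw.integrableOn).1 ht
    filter_upwards [(ae_restrict_iff' (hS1.inter (hgt t))).1 this] with x hx h1 h2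
    exact hx ⟨h1, h2⟩
  have key : ∫ x in {x | r x < m}, d x ∂Q = 0 := by
    refine (hsw m).resolve_left (fun h => ?_)
    have hw := wz m h
    have hz : (fun x => (m - r x) * (1 - d x)) =ᵐ[Q.restrict S1] 0 := by
      refine (integral_eq_zero_iff_of_nonneg_ae ?_ ?_).1 ?_
      · rw [Filter.EventuallyLE, ae_restrict_iff' hS1]
        filter_upwards [hw] with x hx hxS
        by_cases hc : m < r x
        · simp [hx hxS hc]
        · simp only [Pi.zero_apply]
          exact mul_nonneg (by linarith) (by linarith [(hd01 x).2])
      · have : (fun x => (m - r x) * (1 - d x)) = fun x => -((r x - m) * (1 - d x)) := by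
          funext x; ring
        rw [this]; exact hirw.neg.integrableOn
      · have : (fun x => (m - r x) * (1 - d x)) = fun x => -((r x - m) * (1 - d x)) := by
          funext x; ring
        rw [this, integral_neg, h1, neg_zero]
    have : ∫ x in S1, (1 - d x) ∂Q = 0 := by
      refine integral_eq_zero_of_ae ?_
      filter_upwards [hz, ae_restrict_of_ae (hna m)] with x hx hx2
      rcases mul_eq_zero.1 hx with h4 | h4
      · exact absurd (by linarith) hx2
      · exact h4
    linarith
  set E : Set ℝ := {t | t ≤ 1 ∧ ∫ x in {x | r x < t}, d x ∂Q = 0} with hE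
  have hmE : m ∈ E := ⟨hm1.le, key⟩
  have hbdd : BddAbove E := ⟨1, fun t ht => ht.1⟩
  set t0 := sSup E with ht0
  have hmt : m ≤ t0 := le_csSup hbdd hmE
  have ht1 : t0 ≤ 1 := csSup_le ⟨m, hmE⟩ fun t ht => ht.1
  have hlow : ∀ᵐ x ∂Q, r x < t0 → d x = 0 := by
    have : ∀ q : ℚ, ∀ᵐ x ∂Q, (q:ℝ) < t0 → r x < q → d x = 0 := by
      intro q
      by_cases hq : (q:ℝ) < t0
      · obtain ⟨t, htE, hqt⟩ := exists_lt_of_lt_csSup ⟨m, hmE⟩ hq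
        filter_upwards [dz t htE.2] with x hx _ hxq
        exact hx (hxq.trans hqt)
      · exact Filter.Eventually.of_forall fun x h => absurd h hq
    filter_upwards [ae_all_iff.2 this] with x hx hxt
    obtain ⟨q, hq1, hq2⟩ := exists_rat_btwn hxt
    exact hx q hq2 hq1
  have hhigh : ∀ᵐ x ∂Q, x ∈ S1 → t0 < r x → 1 - d x = 0 := by
    have : ∀ q : ℚ, ∀ᵐ x ∂Q, t0 < (q:ℝ) → x ∈ S1 → q < r x → 1 - d x = 0 := by
      intro q
      by_cases hq : t0 < (q:ℝ)
      · by_cases hq1 : (q:ℝ) ≤ 1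
        · have hn : ¬ ∫ x in {x | r x < q}, d x ∂Q = 0 := fun h =>
            absurd (le_csSup hbdd (show (q:ℝ) ∈ E from ⟨hq1, h⟩)) (not_le.2 hq)
          filter_upwards [wz q ((hsw q).resolve_right hn)] with x hx _ h2 h3
          exact hx h2 h3
        · refine Filter.Eventually.of_forall fun x _ _ h => ?_
          linarith [(hr01 x).2]
      · exact Filter.Eventually.of_forall fun x h => absurd h hq
    filter_upwards [ae_all_iff.2 this] with x hx hxS hxt
    obtain ⟨q, hq1, hq2⟩ := exists_rat_btwn hxt
    exact hx q hq1 hxS hq2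
  obtain ⟨K, hK⟩ := hineq t0 hmt ht1
  have e1 : ∫ x in S1 ∩ {x | r x < t0}, (r x - m) ∂Q = 0 := by
    rw [← h1, ← setIntegral_indicator (hlt t0)]
    refine setIntegral_congr_ae hS1 ?_
    filter_upwards [hlow, hhigh, hna t0] with x hx1 hx2 hx3 hxS
    by_cases h : r x < t0
    · rw [Set.indicator_of_mem (by exact h), hx1 h]; ring
    · rw [Set.indicator_of_notMem (by exact h),
        hx2 hxS (lt_of_le_of_ne (not_lt.1 h) hx3.symm)]; ring
  have e0 : ∫ x in S0 ∩ {x | r x < t0}, (r x - m) ∂Q ≤ 0 := by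
    rw [← h0, ← setIntegral_indicator (hlt t0)]
    refine setIntegral_mono_ae (hirm.indicator (hlt t0)).integrableOn hirw.integrableOn ?_
    filter_upwards [hlow] with x hx1
    by_cases h : r x < t0
    · rw [Set.indicator_of_mem (by exact h), hx1 h]; simp
    · rw [Set.indicator_of_notMem (by exact h)]
      exact mul_nonneg (by linarith [not_lt.1 h]) (by linarith [(hd01 x).2])
  rw [e1] at hK
  linarith

/-- the law of `r` on a group, from the Beta hypothesis -/
lemma cpp_law {Z : Type*} [MeasurableSpace Z] (Q : Measure Z) [IsProbabilityMeasure Q]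
    (r : Z → ℝ) (hr : Measurable r) (S : Set Z) (hS : MeasurableSet S) (hpos : 0 < Q S)
    (p q c : ℝ) (hc : 0 < c)
    (hb : ∀ s : Set ℝ, MeasurableSet s → (Q (r ⁻¹' s ∩ S)).toReal
      = c * ∫ x in s ∩ Set.Ioo (0 : ℝ) 1, x ^ p * (1 - x) ^ q) :
    IntegrableOn (fun x : ℝ => x ^ p * (1 - x) ^ q) (Set.Ioo 0 1) ∧
    (Q.restrict S).map r = (volume.restrict (Set.Ioo (0:ℝ) 1)).withDensity
      (fun x => ENNReal.ofReal (c * (x ^ p * (1 - x) ^ q))) := by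
  have hintg : IntegrableOn (fun x : ℝ => x ^ p * (1 - x) ^ q) (Set.Ioo 0 1) := by
    by_contra h
    have h1 := hb Set.univ MeasurableSet.univ
    rw [Set.univ_inter, integral_undef h] at h1
    simp only [Set.preimage_univ, Set.univ_inter, mul_zero] at h1
    have := ENNReal.toReal_pos hpos.ne' (measure_ne_top Q S)
    linarith
  refine ⟨hintg, ?_⟩
  ext s hs
  rw [Measure.map_apply hr hs, Measure.restrict_apply (hr hs), withDensity_apply _ hs,
    Measure.restrict_restrict hs, ← ofReal_integral_eq_lintegral_ofReal, integral_const_mul,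
    ← hb s hs, ENNReal.ofReal_toReal (measure_ne_top _ _)]
  · exact (hintg.mono_set Set.inter_subset_right).const_mul c
  · refine (ae_restrict_iff' (hs.inter measurableSet_Ioo)).2 (Filter.Eventually.of_forall ?_)
    intro x hx
    have h0 := hx.2.1
    have h1 : 0 < 1 - x := by linarith [hx.2.2]
    simp only [Pi.zero_apply]
    positivity

lemma cpp_law_int {Z : Type*} [MeasurableSpace Z] (Q : Measure Z) [IsProbabilityMeasure Q]
    (r : Z → ℝ) (hr : Measurable r) (S : Set Z)
    (p q c : ℝ) (hc : 0 < c)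
    (hlaw : (Q.restrict S).map r = (volume.restrict (Set.Ioo (0:ℝ) 1)).withDensity
      (fun x => ENNReal.ofReal (c * (x ^ p * (1 - x) ^ q)))) (m t : ℝ) :
    ∫ x in S ∩ {x | r x < t}, (r x - m) ∂Q
      = c * ∫ x in Set.Ioo (0:ℝ) 1, (x ^ p * (1 - x) ^ q) * (Set.Iio t).indicator (fun x => x - m) x := by
  have hg : Measurable ((Set.Iio t).indicator (fun x : ℝ => x - m)) :=
    (measurable_id.sub_const m).indicator measurableSet_Iio
  rw [← setIntegral_indicator (measurableSet_lt hr measurable_const)]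
  have e : ∫ x in S, {x | r x < t}.indicator (fun x => r x - m) x ∂Q
      = ∫ y, (Set.Iio t).indicator (fun x : ℝ => x - m) y ∂((Q.restrict S).map r) := by
    rw [integral_map hr.aemeasurable hg.aestronglyMeasurable]
    rfl
  rw [e, hlaw, integral_withDensity_eq_integral_toReal_smul (by fun_prop)
    (Filter.Eventually.of_forall fun x => ENNReal.ofReal_lt_top), ← integral_const_mul]
  refine setIntegral_congr_fun measurableSet_Ioo (fun x hx => ?_)
  have h0 := hx.1
  have h1 : 0 < 1 - x := by linarith [hx.2]
  simp only [smul_eq_mul]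
  rw [ENNReal.toReal_ofReal (by positivity)]
  ring

lemma cpp_beta_ineq (p0 q0 p1 q1 m t : ℝ) (hp : p1 < p0) (hq : q0 < q1)
    (hm0 : 0 < m) (hm1 : m < 1) (hmt : m ≤ t) (ht : t ≤ 1)
    (i0 : IntegrableOn (fun x : ℝ => x ^ p0 * (1 - x) ^ q0) (Set.Ioo 0 1))
    (i1 : IntegrableOn (fun x : ℝ => x ^ p1 * (1 - x) ^ q1) (Set.Ioo 0 1)) :
    ∃ K : ℝ, K * ∫ x in Set.Ioo (0:ℝ) 1,
        (x ^ p1 * (1 - x) ^ q1) * (Set.Iio t).indicator (fun x => x - m) x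
      < ∫ x in Set.Ioo (0:ℝ) 1,
        (x ^ p0 * (1 - x) ^ q0) * (Set.Iio t).indicator (fun x => x - m) x := by
  let h : ℝ → ℝ := fun x => x ^ (p0 - p1) * (1 - x) ^ (q0 - q1)
  have hmono : ∀ x y, 0 < x → x < y → y < 1 → h x < h y := by
    intro x y hx hxy hy
    have a1 : x ^ (p0 - p1) < y ^ (p0 - p1) := Real.rpow_lt_rpow hx.le hxy (by linarith)
    have a2 : (1 - x) ^ (q0 - q1) < (1 - y) ^ (q0 - q1) :=
      Real.rpow_lt_rpow_of_neg (by linarith) (by linarith) (by linarith)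
    exact mul_lt_mul'' a1 a2 (Real.rpow_nonneg hx.le _) (Real.rpow_nonneg (by linarith) _)
  have hf : ∀ x, 0 < x → x < 1 → x ^ p0 * (1 - x) ^ q0 = h x * (x ^ p1 * (1 - x) ^ q1) := by
    intro x hx hx1
    have b1 : x ^ p0 = x ^ (p0 - p1) * x ^ p1 := by rw [← Real.rpow_add hx]; congr 1; ring
    have b2 : (1 - x) ^ q0 = (1 - x) ^ (q0 - q1) * (1 - x) ^ q1 := by
      rw [← Real.rpow_add (by linarith)]; congr 1; ring
    rw [b1, b2]; ring
  have hgm : Measurable ((Set.Iio t).indicator (fun x : ℝ => x - m)) :=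
    (measurable_id.sub_const m).indicator measurableSet_Iio
  have hI : ∀ f : ℝ → ℝ, IntegrableOn f (Set.Ioo 0 1) →
      IntegrableOn (fun x => f x * (Set.Iio t).indicator (fun x => x - m) x) (Set.Ioo 0 1) := by
    intro f hf
    refine Integrable.mul_bdd (c := 1) hf hgm.aestronglyMeasurable ?_
    refine (ae_restrict_iff' measurableSet_Ioo).2 (Filter.Eventually.of_forall fun x hx => ?_)
    by_cases hx' : x ∈ Set.Iio t
    · rw [Set.indicator_of_mem hx', Real.norm_eq_abs, abs_le]
      constructor <;> linarith [hx.1, hx.2]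
    · rw [Set.indicator_of_notMem hx']; simp
  refine ⟨h m, ?_⟩
  rw [← integral_const_mul, ← sub_pos, ← integral_sub (hI _ i0) ((hI _ i1).const_mul _)]
  have hii := (hI _ i0).sub ((hI _ i1).const_mul (h m))
  have e : ∀ x, 0 < x → x < t → x ^ p0 * (1 - x) ^ q0 * (Set.Iio t).indicator (fun x => x - m) x
      - h m * (x ^ p1 * (1 - x) ^ q1 * (Set.Iio t).indicator (fun x => x - m) x)
      = (x ^ p1 * (1 - x) ^ q1) * ((h x - h m) * (x - m)) := by
    intro x hx hxt
    rw [Set.indicator_of_mem (by exact hxt), hf x hx (by linarith)]; ring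
  have hpos : ∀ x, 0 < x → x < t → x ≠ m →
      0 < (x ^ p1 * (1 - x) ^ q1) * ((h x - h m) * (x - m)) := by
    intro x hx hxt hxm
    have h1x : 0 < 1 - x := by linarith
    refine mul_pos (by positivity) ?_
    rcases lt_or_gt_of_ne hxm with hlt | hgt
    · exact mul_pos_of_neg_of_neg (by linarith [hmono x m hx hlt hm1]) (by linarith)
    · exact mul_pos (by linarith [hmono m x hm0 hgt (by linarith)]) (by linarith)
  refine (setIntegral_pos_iff_support_of_nonneg_ae ?_ hii).2 ?_
  rotate_left
  · refine lt_of_lt_of_le ?_ (measure_mono (show Set.Ioo 0 m ⊆ _ from ?_))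
    · simp [hm0]
    · intro x hx
      refine ⟨?_, hx.1, hx.2.trans hm1⟩
      rw [Function.mem_support]
      have hxt := hx.2.trans_le hmt
      simp only [Pi.sub_apply]
      rw [e x hx.1 hxt]
      exact (hpos x hx.1 hxt hx.2.ne).ne'
  · refine (ae_restrict_iff' measurableSet_Ioo).2 (Filter.Eventually.of_forall fun x hx => ?_)
    simp only [Pi.zero_apply, Pi.sub_apply]
    by_cases hxt : x < t
    · rw [e x hx.1 hxt]
      by_cases hxm : x = m
      · simp [hxm]
      · exact (hpos x hx.1 hxt hxm).le
    · rw [Set.indicator_of_notMem (by exact hxt)]; simp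

/-- integrating out the uniform randomization -/
lemma cpp_unif {Ω Z : Type*} [MeasurableSpace Ω] [MeasurableSpace Z]
    (P : Measure Ω) [IsProbabilityMeasure P]
    (X : Ω → Z) (hX : Measurable X) (U : Ω → ℝ) (hU : Measurable U)
    (hUunif : Measure.map U P = volume.restrict (Set.Icc (0 : ℝ) 1))
    (hindep : ProbabilityTheory.IndepFun U X P)
    (d : Z → ℝ) (hd : Measurable d) (hd01 : ∀ x, d x ∈ Set.Icc (0 : ℝ) 1)
    (S : Set Z) (hS : MeasurableSet S) (g : Z → ℝ) (hg : Measurable g) (hg1 : ∀ x, |g x| ≤ 1) :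
    ∫ ω in {ω | ¬ U ω ≤ d (X ω)} ∩ {ω | X ω ∈ S}, g (X ω) ∂P
      = ∫ x in S, g x * (1 - d x) ∂(P.map X) := by
  have hprod := (ProbabilityTheory.indepFun_iff_map_prod_eq_prod_map_map
    hU.aemeasurable hX.aemeasurable).1 hindep
  have : IsProbabilityMeasure (P.map X) := Measure.isProbabilityMeasure_map hX.aemeasurable
  have : IsProbabilityMeasure (P.map U) := Measure.isProbabilityMeasure_map hU.aemeasurable
  let B : Set (ℝ × Z) := {z | ¬ z.1 ≤ d z.2} ∩ {z | z.2 ∈ S}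
  have hB : MeasurableSet B :=
    (measurableSet_le measurable_fst (hd.comp measurable_snd)).compl.inter (measurable_snd hS)
  have hFm : Measurable (B.indicator (fun z => g z.2)) := (hg.comp measurable_snd).indicator hB
  have hBΩ : MeasurableSet ({ω | ¬ U ω ≤ d (X ω)} ∩ {ω | X ω ∈ S}) :=
    (measurableSet_le hU (hd.comp hX)).compl.inter (hX hS)
  have e : ∫ ω in {ω | ¬ U ω ≤ d (X ω)} ∩ {ω | X ω ∈ S}, g (X ω) ∂P
      = ∫ z, B.indicator (fun z => g z.2) z ∂((P.map U).prod (P.map X)) := by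
    rw [← hprod, integral_map (hU.prodMk hX).aemeasurable hFm.aestronglyMeasurable,
      ← integral_indicator hBΩ]
    rfl
  have hintg : Integrable (B.indicator (fun z => g z.2)) ((P.map U).prod (P.map X)) := by
    refine cpp_int _ _ hFm 1 (fun z => ?_)
    by_cases h : z ∈ B
    · rw [Set.indicator_of_mem h]; exact hg1 _
    · rw [Set.indicator_of_notMem h]; simp
  rw [e, integral_prod_symm _ hintg, ← integral_indicator hS]
  refine integral_congr_ae (Filter.Eventually.of_forall fun x => ?_)
  simp only
  by_cases hx : x ∈ S
  · rw [Set.indicator_of_mem hx]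
    have : (fun u : ℝ => B.indicator (fun z => g z.2) (u, x))
        = (Set.Ioi (d x)).indicator (fun _ => g x) := by
      funext u
      by_cases hu : d x < u
      · have hB1 : (u, x) ∈ B := ⟨not_le.2 hu, hx⟩
        have hB2 : u ∈ Set.Ioi (d x) := hu
        rw [Set.indicator_of_mem hB1, Set.indicator_of_mem hB2]
      · have hB1 : (u, x) ∉ B := fun h => hu (not_le.1 h.1)
        have hB2 : u ∉ Set.Ioi (d x) := hu
        rw [Set.indicator_of_notMem hB1, Set.indicator_of_notMem hB2]
    rw [this, integral_indicator measurableSet_Ioi, setIntegral_const, hUunif, measureReal_def,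
      Measure.restrict_apply measurableSet_Ioi]
    have : Set.Ioi (d x) ∩ Set.Icc 0 1 = Set.Ioc (d x) 1 := by
      ext u
      have := (hd01 x).1
      simp only [Set.mem_inter_iff, Set.mem_Ioi, Set.mem_Icc, Set.mem_Ioc]
      constructor
      · rintro ⟨a, b, c⟩; exact ⟨a, c⟩
      · rintro ⟨a, c⟩; exact ⟨a, by linarith, c⟩
    rw [this, Real.volume_Ioc, ENNReal.toReal_ofReal (by linarith [(hd01 x).2]), smul_eq_mul]
    ring
  · rw [Set.indicator_of_notMem hx]
    refine integral_eq_zero_of_ae (Filter.Eventually.of_forall fun u => ?_)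
    have hB1 : (u, x) ∉ B := fun h => hx h.2
    exact Set.indicator_of_notMem hB1 _

/-- With two groups whose conditional risk distributions are Beta with mean
`μ_a` and sample size `v` (shape parameters `(μ_a·v, (1 − μ_a)·v)`), where `v > 2` and
`μ_{a₀} > μ_{a₁} > 1/v`, any feasible policy satisfying counterfactual predictive parity
(equal conditional mean risk among rejected individuals) is strongly Pareto dominated with
respect to the family `u_λ(x) = r(x) + λ·1{α(x) = a₁}`, `λ ≥ 0`. -/
theorem counterfactual_predictive_parity_dominated_mean_sample_size
    {Ω 𝒳 𝒜 : Type*} [MeasurableSpace Ω] [MeasurableSpace 𝒳]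
    [MeasurableSpace 𝒜] [MeasurableSingletonClass 𝒜] [DecidableEq 𝒜]
    (P : Measure Ω) [IsProbabilityMeasure P]
    (X : Ω → 𝒳) (hX : Measurable X)
    (U : Ω → ℝ) (hU : Measurable U)
    -- `U` is uniform on `[0,1]` and independent of `X`
    (hUunif : Measure.map U P = volume.restrict (Set.Icc (0 : ℝ) 1))
    (hindep : ProbabilityTheory.IndepFun U X P)
    (α : 𝒳 → 𝒜) (hα : Measurable α)
    -- `𝒜 = {a₀, a₁}`, both groups of positive probability
    (a₀ a₁ : 𝒜) (hne : a₀ ≠ a₁) (hall : ∀ a, a = a₀ ∨ a = a₁)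
    (hposgrp : ∀ a, 0 < P {ω | α (X ω) = a})
    (r : 𝒳 → ℝ) (hr : Measurable r) (hr01 : ∀ x, r x ∈ Set.Icc (0 : ℝ) 1)
    -- the conditional distribution of `r(X)` given `A = a` is Beta with mean `μa a`
    -- and sample size `v`, i.e. Beta with shape parameters `(μa a * v, (1 - μa a) * v)`
    (μa : 𝒜 → ℝ) (v : ℝ)
    (hbeta : ∀ a, ∃ c : ℝ, 0 < c ∧ ∀ s : Set ℝ, MeasurableSet s →
      (P ({ω | r (X ω) ∈ s} ∩ {ω | α (X ω) = a})).toReal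
        = c * ∫ x in s ∩ Set.Ioo (0 : ℝ) 1,
            x ^ (μa a * v - 1) * (1 - x) ^ ((1 - μa a) * v - 1))
    (hv : 2 < v) (hμ₀ : μa a₁ < μa a₀) (hμ₁ : 1 / v < μa a₁)
    -- the budget
    (b : ℝ) (hb0 : 0 < b) (hb1 : b < 1)
    -- `d` is a feasible policy
    (d : 𝒳 → ℝ) (hd : Measurable d) (hd01 : ∀ x, d x ∈ Set.Icc (0 : ℝ) 1)
    (hfeas : ∫ ω, d (X ω) ∂P ≤ b)
    -- counterfactual predictive parity: `E[r(X) | A = a₀, D = 0] = E[r(X) | A = a₁, D = 0]`,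
    -- where `D = 1{U ≤ d(X)}`
    (hcpp :
      (∫ ω in {ω | ¬ U ω ≤ d (X ω)} ∩ {ω | α (X ω) = a₀}, r (X ω) ∂P)
          / (P ({ω | ¬ U ω ≤ d (X ω)} ∩ {ω | α (X ω) = a₀})).toReal
        = (∫ ω in {ω | ¬ U ω ≤ d (X ω)} ∩ {ω | α (X ω) = a₁}, r (X ω) ∂P)
          / (P ({ω | ¬ U ω ≤ d (X ω)} ∩ {ω | α (X ω) = a₁})).toReal) :
    -- then `d` is strongly Pareto dominated with respect to `{u_λ : λ ≥ 0}`
    ∃ d' : 𝒳 → ℝ, Measurable d' ∧ (∀ x, d' x ∈ Set.Icc (0 : ℝ) 1) ∧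
      (∫ ω, d' (X ω) ∂P ≤ b) ∧
      ∀ lam : ℝ, 0 ≤ lam →
        (∫ ω, d (X ω) * (r (X ω) + lam * (if α (X ω) = a₁ then 1 else 0)) ∂P)
          < ∫ ω, d' (X ω) * (r (X ω) + lam * (if α (X ω) = a₁ then 1 else 0)) ∂P := by
  by_contra hcon
  let Q : Measure 𝒳 := P.map X
  have hQ : IsProbabilityMeasure Q := Measure.isProbabilityMeasure_map hX.aemeasurable
  let S : 𝒜 → Set 𝒳 := fun a => {x | α x = a}
  have hS : ∀ a, MeasurableSet (S a) := fun a => hα (measurableSet_singleton a)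
  have hQS : ∀ a, 0 < Q (S a) := by
    intro a
    rw [Measure.map_apply hX (hS a)]; exact hposgrp a
  have hpush : ∀ f : 𝒳 → ℝ, Measurable f → ∫ ω, f (X ω) ∂P = ∫ x, f x ∂Q := fun f hf =>
    (integral_map hX.aemeasurable hf.aestronglyMeasurable).symm
  have hda : ∀ x, |d x| ≤ 1 := fun x => abs_le.2 ⟨by linarith [(hd01 x).1], (hd01 x).2⟩
  have hra : ∀ x, |r x| ≤ 1 := fun x => abs_le.2 ⟨by linarith [(hr01 x).1], (hr01 x).2⟩
  have hwa : ∀ x, |1 - d x| ≤ 1 :=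
    fun x => abs_le.2 ⟨by linarith [(hd01 x).2], by linarith [(hd01 x).1]⟩
  have hwm : Measurable (fun x => 1 - d x) := measurable_const.sub hd
  have hid : Integrable d Q := cpp_int Q d hd 1 hda
  have hiw : Integrable (fun x => 1 - d x) Q := cpp_int Q _ hwm 1 hwa
  have hirw : Integrable (fun x => r x * (1 - d x)) Q := by
    refine cpp_int Q _ (hr.mul hwm) 1 (fun x => ?_)
    rw [abs_mul]; exact mul_le_one₀ (hra x) (abs_nonneg _) (hwa x)
  -- the laws
  have hlaws : ∀ a, ∃ c : ℝ, 0 < c ∧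
      IntegrableOn (fun x : ℝ => x ^ (μa a * v - 1) * (1 - x) ^ ((1 - μa a) * v - 1))
        (Set.Ioo 0 1) ∧
      (Q.restrict (S a)).map r = (volume.restrict (Set.Ioo (0:ℝ) 1)).withDensity
        (fun x => ENNReal.ofReal (c * (x ^ (μa a * v - 1) * (1 - x) ^ ((1 - μa a) * v - 1)))) := by
    intro a
    obtain ⟨c, hc, hb⟩ := hbeta a
    refine ⟨c, hc, cpp_law Q r hr (S a) (hS a) (hQS a) _ _ c hc (fun s hs => ?_)⟩
    rw [← hb s hs, Measure.map_apply hX ((hr hs).inter (hS a))]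
    rfl
  have hnaS : ∀ a y, Q ({x | r x = y} ∩ S a) = 0 := by
    intro a y
    obtain ⟨c, hc, -, hlaw⟩ := hlaws a
    have h1 : (Q.restrict (S a)).map r {y} = 0 := by
      rw [hlaw]
      exact withDensity_absolutelyContinuous _ _ (by simp)
    rw [Measure.map_apply hr (measurableSet_singleton y),
      Measure.restrict_apply (hr (measurableSet_singleton y))] at h1
    exact h1
  have hna : ∀ y, ∀ᵐ x ∂Q, r x ≠ y := by
    intro y
    rw [ae_iff]
    refine measure_mono_null ?_ (measure_union_null (hnaS a₀ y) (hnaS a₁ y))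
    intro x hx
    have hx' : r x = y := not_not.1 hx
    rcases hall (α x) with h | h
    · exact Or.inl ⟨hx', h⟩
    · exact Or.inr ⟨hx', h⟩
  have hr0 : ∀ᵐ x ∂Q, 0 < r x := by
    filter_upwards [hna 0] with x hx
    exact lt_of_le_of_ne (hr01 x).1 hx.symm
  have hr1 : ∀ᵐ x ∂Q, r x < 1 := by
    filter_upwards [hna 1] with x hx
    exact lt_of_le_of_ne (hr01 x).2 hx
  -- CPP on `Q`
  let N : 𝒜 → ℝ := fun a => ∫ x in S a, r x * (1 - d x) ∂Q
  let W : 𝒜 → ℝ := fun a => ∫ x in S a, (1 - d x) ∂Q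
  have hN : ∀ a, ∫ ω in {ω | ¬ U ω ≤ d (X ω)} ∩ {ω | α (X ω) = a}, r (X ω) ∂P = N a := fun a =>
    cpp_unif P X hX U hU hUunif hindep d hd hd01 (S a) (hS a) r hr hra
  have hW : ∀ a, (P ({ω | ¬ U ω ≤ d (X ω)} ∩ {ω | α (X ω) = a})).toReal = W a := by
    intro a
    have := cpp_unif P X hX U hU hUunif hindep d hd hd01 (S a) (hS a) (fun _ => 1)
      measurable_const (fun _ => by simp)
    simp only [one_mul, setIntegral_const, smul_eq_mul, mul_one] at this
    exact this
  rw [hN, hN, hW, hW] at hcpp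
  have hWnn : ∀ a, 0 ≤ W a := fun a => integral_nonneg fun x => by
    simp only [Pi.zero_apply]; linarith [(hd01 x).2]
  -- positivity of weighted integrals
  have hposint : ∀ a, ∀ f : 𝒳 → ℝ, Measurable f → (∀ x, f x ∈ Set.Icc (0:ℝ) 1) →
      (∀ᵐ x ∂Q, 0 < f x) → 0 < W a → 0 < ∫ x in S a, f x * (1 - d x) ∂Q := by
    intro a f hf hf01 hfp hWa
    have hnn : 0 ≤ fun x => f x * (1 - d x) := fun x =>
      mul_nonneg (hf01 x).1 (by linarith [(hd01 x).2])
    have hii : Integrable (fun x => f x * (1 - d x)) Q := by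
      refine cpp_int Q _ (hf.mul hwm) 1 (fun x => ?_)
      rw [abs_mul]
      exact mul_le_one₀ (abs_le.2 ⟨by linarith [(hf01 x).1], (hf01 x).2⟩) (abs_nonneg _) (hwa x)
    refine lt_of_le_of_ne (integral_nonneg hnn) (fun h0 => ?_)
    have hz := (integral_eq_zero_iff_of_nonneg hnn hii.integrableOn).1 h0.symm
    have : W a = 0 := by
      refine integral_eq_zero_of_ae ?_
      filter_upwards [hz, ae_restrict_of_ae hfp] with x hx hx2
      rcases mul_eq_zero.1 hx with h | h
      · linarith
      · exact h
    linarith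
  have hNpos : ∀ a, 0 < W a → 0 < N a := fun a h => hposint a r hr hr01 hr0 h
  have hsum : 0 < W a₀ + W a₁ := by
    have hc : S a₁ = (S a₀)ᶜ := by
      ext x
      simp only [S, Set.mem_ofPred_eq, Set.mem_compl_iff]
      constructor
      · intro h h'; exact hne (h'.symm.trans h)
      · intro h; exact (hall (α x)).resolve_left h
    have h1 : W a₀ + W a₁ = ∫ x, (1 - d x) ∂Q := by
      simp only [W, hc]
      exact integral_add_compl (hS a₀) hiw
    rw [h1, integral_sub (integrable_const _) hid, ← hpush d hd]
    simp
    linarith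
  have hW1 : 0 < W a₁ := by
    refine lt_of_le_of_ne (hWnn a₁) (fun h => ?_)
    have h0 : 0 < W a₀ := by linarith
    rw [← h, div_zero] at hcpp
    have := div_pos (hNpos a₀ h0) h0
    linarith
  have hW0 : 0 < W a₀ := by
    refine lt_of_le_of_ne (hWnn a₀) (fun h => ?_)
    rw [← h, div_zero] at hcpp
    have := div_pos (hNpos a₁ hW1) hW1
    linarith
  obtain ⟨m, hm⟩ : ∃ m, m = N a₁ / W a₁ := ⟨_, rfl⟩
  have hm0 : 0 < m := hm ▸ div_pos (hNpos a₁ hW1) hW1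
  have hNW : ∀ a, ∫ x in S a, (r x - m) * (1 - d x) ∂Q = N a - m * W a := by
    intro a
    simp only [N, W]
    rw [← integral_const_mul, ← integral_sub hirw.integrableOn (hiw.const_mul m).integrableOn]
    congr 1; funext x; ring
  have hm1 : m < 1 := by
    rw [hm, div_lt_one hW1]
    have := hposint a₁ (fun x => 1 - r x) (measurable_const.sub hr)
      (fun x => ⟨by linarith [(hr01 x).2], by linarith [(hr01 x).1]⟩)
      (by filter_upwards [hr1] with x hx; linarith) hW1
    have e : ∫ x in S a₁, (1 - r x) * (1 - d x) ∂Q = W a₁ - N a₁ := by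
      simp only [N, W]
      rw [← integral_sub hiw.integrableOn hirw.integrableOn]
      congr 1; funext x; ring
    linarith
  have hlt : ∀ t, MeasurableSet {x | r x < t} := fun t => measurableSet_lt hr measurable_const
  have hgt : ∀ t, MeasurableSet {x | t < r x} := fun t => measurableSet_lt measurable_const hr
  refine cpp_core Q r d hr hr01 hd hd01 (S a₀) (S a₁) (hS a₀) (hS a₁) hna m hm0 hm1
    ?_ ?_ hW1 ?_ ?_
  · rw [hNW, hm]; field_simp; ring
  · rw [hNW, hm, ← hcpp]; field_simp; ring
  · intro t hmt ht1
    obtain ⟨c0, hc0, i0, l0⟩ := hlaws a₀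
    obtain ⟨c1, hc1, i1, l1⟩ := hlaws a₁
    obtain ⟨K, hK⟩ := cpp_beta_ineq _ _ _ _ m t (by nlinarith) (by nlinarith) hm0 hm1 hmt ht1 i0 i1
    refine ⟨c0 * K / c1, ?_⟩
    rw [cpp_law_int Q r hr (S a₀) _ _ c0 hc0 l0, cpp_law_int Q r hr (S a₁) _ _ c1 hc1 l1]
    rw [← mul_assoc, div_mul_cancel₀ _ hc1.ne', mul_assoc]
    exact mul_lt_mul_of_pos_left hK hc0
  · intro t
    by_contra hor
    rw [not_or] at hor
    have p1 : 0 < ∫ x in S a₁ ∩ {x | t < r x}, (1 - d x) ∂Q :=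
      lt_of_le_of_ne (integral_nonneg fun x => by
        simp only [Pi.zero_apply]; linarith [(hd01 x).2]) (Ne.symm hor.1)
    have p2 : 0 < ∫ x in {x | r x < t}, d x ∂Q :=
      lt_of_le_of_ne (integral_nonneg fun x => (hd01 x).1) (Ne.symm hor.2)
    obtain ⟨d', hd', hdp01, he, hlt', hle⟩ := cpp_swap Q r d hr hr01 hd hd01 (S a₁)
      (S a₁ ∩ {x | t < r x}) {x | r x < t} (hS a₁) ((hS a₁).inter (hgt t)) (hlt t) t
      (fun x hx => ⟨hx.2, hx.1⟩) (fun x hx => hx) p1 p2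
    refine hcon ⟨d', hd', hdp01, ?_, ?_⟩
    · rw [hpush d' hd', he, ← hpush d hd]; exact hfeas
    · intro lam hlam
      have hut : ∀ f : 𝒳 → ℝ, Measurable f → (∀ x, f x ∈ Set.Icc (0:ℝ) 1) →
          ∫ ω, f (X ω) * (r (X ω) + lam * (if α (X ω) = a₁ then 1 else 0)) ∂P
            = ∫ x, f x * r x ∂Q + lam * ∫ x in S a₁, f x ∂Q := by
        intro f hf hf01
        have hfa : ∀ x, |f x| ≤ 1 := fun x => abs_le.2 ⟨by linarith [(hf01 x).1], (hf01 x).2⟩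
        have j1 : Integrable (fun x => f x * r x) Q := by
          refine cpp_int Q _ (hf.mul hr) 1 (fun x => ?_)
          rw [abs_mul]; exact mul_le_one₀ (hfa x) (abs_nonneg _) (hra x)
        have j2 : Integrable f Q := cpp_int Q f hf 1 hfa
        have hm' : Measurable (fun x => f x * r x + lam * (S a₁).indicator f x) :=
          (hf.mul hr).add ((hf.indicator (hS a₁)).const_mul lam)
        rw [← integral_indicator (hS a₁), ← integral_const_mul,
          ← integral_add j1 ((j2.indicator (hS a₁)).const_mul lam), ← hpush _ hm']
        congr 1; funext ω
        by_cases h : α (X ω) = a₁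
        · rw [Set.indicator_of_mem (by exact h), if_pos h]; ring
        · rw [Set.indicator_of_notMem (by exact h), if_neg h]; ring
      rw [hut d hd hd01, hut d' hd' hdp01]
      have := mul_le_mul_of_nonneg_left hle hlam
      linarith
end
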